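/- Let (R,m) be a Cohen-Macaulay local ring which has a dualizing module and let C be a semidualizing R-module. Then C is a dualizing R-module if and only if the G_C-injective dimension G_C-id_R H_a^n(R) is finite for some ideal a of R such that R is relative Cohen-Macaulay with respect to a and ht_R(a) = n. -/

import Mathlib

/-!
Common definitions: semidualizing modules, `C`-injective modules and dimensions,
`G_C`-injective modules, Bass/Auslander classes, relative Cohen-Macaulayness,
Cohen-Macaulay and Gorenstein local rings, trivial extensions, ideal torsion.
-/

noncomputable section

open CategoryTheory TensorProduct

universe u

variable (R : Type u) [CommRing R]

/-- An `R`-module `M` is `C`-injective if it is isomorphic to `Hom_R(C, I)`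
for some injective `R`-module `I`. -/
def IsCInjective (C M : ModuleCat.{u} R) : Prop :=
  ∃ I : ModuleCat.{u} R, Module.Injective R I ∧ Nonempty (M ≃ₗ[R] (C →ₗ[R] I))

/-- `HasCoresDimLE R P n M` : the module `M` admits a coresolution of length at most `n`
by modules satisfying the property `P`. -/
def HasCoresDimLE (P : ModuleCat.{u} R → Prop) : ℕ → ModuleCat.{u} R → Prop
  | 0, M => Subsingleton M ∨ P M
  | n + 1, M => Subsingleton M ∨ ∃ (X : ModuleCat.{u} R) (f : M →ₗ[R] X),
      P X ∧ Function.Injective f ∧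
        HasCoresDimLE P n (ModuleCat.of R (X ⧸ LinearMap.range f))

/-- The coresolution dimension of `M` with respect to the class of modules satisfying `P`,
as an element of `ℕ∞` (`⊤` meaning no finite coresolution exists). -/
def coresDim (P : ModuleCat.{u} R → Prop) (M : ModuleCat.{u} R) : ℕ∞ :=
  sInf {d : ℕ∞ | ∃ n : ℕ, d = n ∧ HasCoresDimLE R P n M}

/-- The `C`-injective dimension of `M`. -/
def cinjDim (C M : ModuleCat.{u} R) : ℕ∞ :=
  coresDim R (IsCInjective R C) M

/-- The injective dimension of `M`. -/
def injDim (M : ModuleCat.{u} R) : ℕ∞ :=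
  coresDim R (fun N => Module.Injective R N) M

/-- A finitely generated `R`-module `C` is semidualizing if the natural map
`R → Hom_R(C,C)` is bijective and `Ext_R^i(C,C) = 0` for all `i ≥ 1`. -/
def IsSemidualizing (C : ModuleCat.{u} R) : Prop :=
  Module.Finite R C ∧ Function.Bijective (LinearMap.lsmul R C) ∧
    ∀ i : ℕ, 1 ≤ i →
      Subsingleton (((Ext R (ModuleCat.{u} R) i).obj (Opposite.op C)).obj C)

/-- A dualizing module is a semidualizing module of finite injective dimension. -/
def IsDualizing (C : ModuleCat.{u} R) : Prop :=
  IsSemidualizing R C ∧ injDim R C ≠ ⊤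

/-- A complete `I_C I`-resolution: an exact complex `Y` (with `d i : Y (i+1) → Y i`)
which stays exact after applying `Hom_R(I, -)` for every `C`-injective `I`, whose terms
in positive degrees are `C`-injective and whose terms in degrees `≤ 0` are injective. -/
structure CompleteICIResolution (C : ModuleCat.{u} R) where
  Y : ℤ → ModuleCat.{u} R
  d : (i : ℤ) → (Y (i + 1) →ₗ[R] Y i)
  exact : ∀ i : ℤ, Function.Exact (d (i + 1)) (d i)
  cinj_pos : ∀ i : ℤ, 0 < i → IsCInjective R C (Y i)
  inj_nonpos : ∀ i : ℤ, i ≤ 0 → Module.Injective R (Y i)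
  homExact : ∀ I : ModuleCat.{u} R, IsCInjective R C I → ∀ i : ℤ,
    Function.Exact (fun f : I →ₗ[R] Y (i + 1 + 1) => (d (i + 1)).comp f)
      (fun f : I →ₗ[R] Y (i + 1) => (d i).comp f)

/-- A module is `G_C`-injective if it is the kernel of the degree-`0` differential of some
complete `I_C I`-resolution. -/
def IsGCInjective (C M : ModuleCat.{u} R) : Prop :=
  ∃ res : CompleteICIResolution R C,
    Nonempty (M ≃ₗ[R] ↥(LinearMap.ker (res.d (-1))))

/-- The `G_C`-injective dimension of `M`. -/
def gcinjDim (C M : ModuleCat.{u} R) : ℕ∞ :=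
  coresDim R (IsGCInjective R C) M

/-- `M` is relative Cohen-Macaulay with respect to `a`: there is exactly one
non-vanishing local cohomology module of `M` with respect to `a`. -/
def IsRelativeCM (a : Ideal R) (M : ModuleCat.{u} R) : Prop :=
  ∃! n : ℕ, Nontrivial ((localCohomology a n).obj M)

/-- `M` is relative Cohen-Macaulay with respect to `a`, with (unique) non-vanishing
local cohomology in degree `n`. -/
def IsRelativeCMAt (a : Ideal R) (n : ℕ) (M : ModuleCat.{u} R) : Prop :=
  Nontrivial ((localCohomology a n).obj M) ∧
    ∀ i : ℕ, i ≠ n → Subsingleton ((localCohomology a i).obj M)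

/-- The cohomological dimension `cd(a, M)`: the largest `i` with `H_a^i(M) ≠ 0`. -/
def lcCohomDim (a : Ideal R) (M : ModuleCat.{u} R) : ℕ :=
  sSup {i : ℕ | Nontrivial ((localCohomology a i).obj M)}

/-- The grade `grade(a, M)`: the least `i` with `H_a^i(M) ≠ 0`. -/
def lcGrade (a : Ideal R) (M : ModuleCat.{u} R) : ℕ :=
  sInf {i : ℕ | Nontrivial ((localCohomology a i).obj M)}

/-- A Noetherian local ring is Cohen-Macaulay iff `H_m^i(R) = 0` for all `i ≠ dim R`
(Grothendieck's characterization, taken here as the definition). -/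
def IsCohenMacaulayLocalRing (S : Type u) [CommRing S] [IsLocalRing S] : Prop :=
  ∀ i : ℕ, (i : WithBot ℕ∞) ≠ ringKrullDim S →
    Subsingleton ((localCohomology (IsLocalRing.maximalIdeal S) i).obj (ModuleCat.of S S))

/-- A local ring is Gorenstein if it has finite injective dimension over itself. -/
def IsGorensteinLocalRing (S : Type u) [CommRing S] : Prop :=
  injDim S (ModuleCat.of S S) ≠ ⊤

/-- The `a`-torsion submodule `Γ_a(M)` of `M`. -/
def idealTorsion (a : Ideal R) (M : Type u) [AddCommGroup M] [Module R M] :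
    Submodule R M :=
  ⨆ n : ℕ, Submodule.torsionBySet R M ((a ^ n : Ideal R) : Set R)

/-- The Krull dimension of a module, `dim_S N = dim (S / ann_S N)`. -/
def moduleKrullDim (S : Type u) [CommRing S] (N : Type u) [AddCommGroup N] [Module S N] :
    WithBot ℕ∞ :=
  ringKrullDim (S ⧸ Module.annihilator S N)

/-- `ht_M(a) = inf { dim_{R_p} M_p  |  p ∈ Supp (M / a M) }`. -/
def heightWRT (a : Ideal R) (M : Type u) [AddCommGroup M] [Module R M] : WithBot ℕ∞ :=
  ⨅ (p : PrimeSpectrum R) (_ : p ∈ Module.support R (M ⧸ (a • (⊤ : Submodule R M)))),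
    moduleKrullDim (Localization.AtPrime p.asIdeal) (LocalizedModule p.asIdeal.primeCompl M)

/-- Membership in the Bass class `B_C(R)`. -/
def MemBassClass (C M : ModuleCat.{u} R) : Prop :=
  (∀ i : ℕ, 1 ≤ i →
      Subsingleton (((Ext R (ModuleCat.{u} R) i).obj (Opposite.op C)).obj M)) ∧
  (∀ i : ℕ, 1 ≤ i →
      Subsingleton (((Tor (ModuleCat.{u} R) i).obj C).obj (ModuleCat.of R (C →ₗ[R] M)))) ∧
  Function.Bijective
    (TensorProduct.lift ((LinearMap.id : (C →ₗ[R] M) →ₗ[R] (C →ₗ[R] M)).flip))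

/-- Membership in the Auslander class `A_C(R)`. -/
def MemAuslanderClass (C M : ModuleCat.{u} R) : Prop :=
  (∀ i : ℕ, 1 ≤ i →
      Subsingleton (((Tor (ModuleCat.{u} R) i).obj C).obj M)) ∧
  (∀ i : ℕ, 1 ≤ i →
      Subsingleton (((Ext R (ModuleCat.{u} R) i).obj (Opposite.op C)).obj
        (ModuleCat.of R (↥C ⊗[R] ↥M)))) ∧
  Function.Bijective ((TensorProduct.mk R ↥C ↥M).flip)

/-- `HasResDimLE R P n M` : `M` admits a resolution of length at most `n`
by modules satisfying `P`. -/
def HasResDimLE (P : ModuleCat.{u} R → Prop) : ℕ → ModuleCat.{u} R → Prop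
  | 0, M => Subsingleton M ∨ P M
  | n + 1, M => Subsingleton M ∨ ∃ (X : ModuleCat.{u} R) (f : X →ₗ[R] M),
      P X ∧ Function.Surjective f ∧
        HasResDimLE P n (ModuleCat.of R ↥(LinearMap.ker f))

/-- The projective dimension of `M`. -/
def projDim (M : ModuleCat.{u} R) : ℕ∞ :=
  sInf {d : ℕ∞ | ∃ n : ℕ, d = n ∧ HasResDimLE R (fun N => Module.Projective R N) n M}

/-- The first projection of the trivial extension `R ⋉ C`, as a ring homomorphism. -/
def trivExtFst (C : Type u) [AddCommGroup C] [Module R C] [Module Rᵐᵒᵖ C]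
    [IsCentralScalar R C] : TrivSqZeroExt R C →+* R where
  toFun := TrivSqZeroExt.fst
  map_one' := TrivSqZeroExt.fst_one (R := R) (M := C)
  map_mul' := TrivSqZeroExt.fst_mul
  map_zero' := TrivSqZeroExt.fst_zero (R := R) (M := C)
  map_add' := TrivSqZeroExt.fst_add

/-- The ideal `a ⊕ C` of the trivial extension `R ⋉ C`. -/
def trivExtIdeal (a : Ideal R) (C : Type u) [AddCommGroup C] [Module R C] [Module Rᵐᵒᵖ C]
    [IsCentralScalar R C] : Ideal (TrivSqZeroExt R C) :=
  Ideal.comap (trivExtFst R C) a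

/-- An `R`-module `M`, viewed as a module over the trivial extension `R ⋉ C` via the
natural surjection `R ⋉ C → R`. -/
def trivExtModuleCat (C : Type u) [AddCommGroup C] [Module R C] [Module Rᵐᵒᵖ C]
    [IsCentralScalar R C] (M : Type u) [AddCommGroup M] [Module R M] :
    ModuleCat.{u} (TrivSqZeroExt R C) :=
  letI := Module.compHom M (trivExtFst R C)
  ModuleCat.of (TrivSqZeroExt R C) M

end

noncomputable section

open CategoryTheory TensorProduct

universe u

section ExtMod

variable (R : Type u) [CommRing R]

/-- `Ext` of modules, unbundled. -/
abbrev ExtMod (X Y : Type u) [AddCommGroup X] [Module R X] [AddCommGroup Y] [Module R Y]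
    (i : ℕ) : Type u :=
  Abelian.Ext (ModuleCat.of R X) (ModuleCat.of R Y) i

variable {R}

/-- Short exact sequences of modules, unbundled. -/
structure IsSES {A B D : Type u} [AddCommGroup A] [Module R A] [AddCommGroup B] [Module R B]
    [AddCommGroup D] [Module R D] (f : A →ₗ[R] B) (g : B →ₗ[R] D) : Prop where
  inj : Function.Injective f
  exact : Function.Exact f g
  surj : Function.Surjective g

variable {A B D : Type u} [AddCommGroup A] [Module R A] [AddCommGroup B] [Module R B]
  [AddCommGroup D] [Module R D]
  {X Y Z : Type u} [AddCommGroup X] [Module R X] [AddCommGroup Y] [Module R Y]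
  [AddCommGroup Z] [Module R Z]

lemma IsSES.ker (g : B →ₗ[R] D) (hg : Function.Surjective g) :
    IsSES (LinearMap.ker g).subtype g :=
  ⟨Subtype.val_injective, fun x => by simp, hg⟩

lemma IsSES.range (f : A →ₗ[R] B) (hf : Function.Injective f) :
    IsSES f (LinearMap.range f).mkQ :=
  ⟨hf, fun x => by simp, Submodule.mkQ_surjective _⟩

/-- The short complex attached to a short exact sequence. -/
abbrev IsSES.sc {f : A →ₗ[R] B} {g : B →ₗ[R] D} (h : IsSES f g) :
    ShortComplex (ModuleCat.{u} R) :=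
  ShortComplex.mk (ModuleCat.ofHom f) (ModuleCat.ofHom g) (by
    ext x; exact h.exact.apply_apply_eq_zero x)

lemma IsSES.shortExact {f : A →ₗ[R] B} {g : B →ₗ[R] D} (h : IsSES f g) :
    h.sc.ShortExact where
  exact := (ShortComplex.ShortExact.moduleCat_exact_iff_function_exact _).2 h.exact
  mono_f := (ModuleCat.mono_iff_injective _).2 h.inj
  epi_g := (ModuleCat.epi_iff_surjective _).2 h.surj

namespace ExtMod

/-- Covariant functoriality. -/
def post (X : Type u) [AddCommGroup X] [Module R X] (f : Y →ₗ[R] Z) (i : ℕ) :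
    ExtMod R X Y i →ₗ[R] ExtMod R X Z i :=
  Abelian.Ext.postcompOfLinear (Abelian.Ext.mk₀ (ModuleCat.ofHom f)) R (ModuleCat.of R X)
    (add_zero i)

/-- Contravariant functoriality. -/
def pre (f : X →ₗ[R] Y) (Z : Type u) [AddCommGroup Z] [Module R Z] (i : ℕ) :
    ExtMod R Y Z i →ₗ[R] ExtMod R X Z i :=
  Abelian.Ext.precompOfLinear (Abelian.Ext.mk₀ (ModuleCat.ofHom f)) R (ModuleCat.of R Z)
    (zero_add i)

/-- Covariant connecting map. -/
def δpost (X : Type u) [AddCommGroup X] [Module R X] {f : A →ₗ[R] B} {g : B →ₗ[R] D}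
    (h : IsSES f g) (i : ℕ) : ExtMod R X D i →ₗ[R] ExtMod R X A (i + 1) :=
  Abelian.Ext.postcompOfLinear h.shortExact.extClass R (ModuleCat.of R X) rfl

/-- Contravariant connecting map. -/
def δpre {f : A →ₗ[R] B} {g : B →ₗ[R] D} (h : IsSES f g) (Y : Type u) [AddCommGroup Y]
    [Module R Y] (i : ℕ) : ExtMod R A Y i →ₗ[R] ExtMod R D Y (i + 1) :=
  Abelian.Ext.precompOfLinear h.shortExact.extClass R (ModuleCat.of R Y) (add_comm 1 i)

lemma post_apply (f : Y →ₗ[R] Z) (i : ℕ) (x : ExtMod R X Y i) :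
    post X f i x = x.comp (Abelian.Ext.mk₀ (ModuleCat.ofHom f)) (add_zero i) := rfl

lemma pre_apply (f : X →ₗ[R] Y) (i : ℕ) (x : ExtMod R Y Z i) :
    pre f Z i x = (Abelian.Ext.mk₀ (ModuleCat.ofHom f)).comp x (zero_add i) := rfl

lemma δpost_pre (f : X →ₗ[R] Y) {a : A →ₗ[R] B} {g : B →ₗ[R] D} (h : IsSES a g) (i : ℕ)
    (x : ExtMod R Y D i) : δpost X h i (pre f D i x) = pre f A (i + 1) (δpost Y h i x) :=
  Abelian.Ext.comp_assoc (Abelian.Ext.mk₀ (ModuleCat.ofHom f)) x h.shortExact.extClass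
    (zero_add i) rfl (by simp)

lemma exact_post (X : Type u) [AddCommGroup X] [Module R X] {f : A →ₗ[R] B} {g : B →ₗ[R] D}
    (h : IsSES f g) (i : ℕ) : Function.Exact (post X f i) (post X g i) :=
  (ShortComplex.ab_exact_iff_function_exact _).1
    (Abelian.Ext.covariant_sequence_exact₂' (ModuleCat.of R X) h.shortExact i)

lemma exact_post_δ (X : Type u) [AddCommGroup X] [Module R X] {f : A →ₗ[R] B} {g : B →ₗ[R] D}
    (h : IsSES f g) (i : ℕ) : Function.Exact (post X g i) (δpost X h i) :=
  (ShortComplex.ab_exact_iff_function_exact _).1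
    (Abelian.Ext.covariant_sequence_exact₃' (ModuleCat.of R X) h.shortExact i (i + 1) rfl)

lemma exact_δ_post (X : Type u) [AddCommGroup X] [Module R X] {f : A →ₗ[R] B} {g : B →ₗ[R] D}
    (h : IsSES f g) (i : ℕ) : Function.Exact (δpost X h i) (post X f (i + 1)) :=
  (ShortComplex.ab_exact_iff_function_exact _).1
    (Abelian.Ext.covariant_sequence_exact₁' (ModuleCat.of R X) h.shortExact i (i + 1) rfl)

lemma exact_pre {f : A →ₗ[R] B} {g : B →ₗ[R] D} (h : IsSES f g) (Y : Type u) [AddCommGroup Y]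
    [Module R Y] (i : ℕ) : Function.Exact (pre g Y i) (pre f Y i) :=
  (ShortComplex.ab_exact_iff_function_exact _).1
    (Abelian.Ext.contravariant_sequence_exact₂' h.shortExact (ModuleCat.of R Y) i)

lemma exact_pre_δ {f : A →ₗ[R] B} {g : B →ₗ[R] D} (h : IsSES f g) (Y : Type u) [AddCommGroup Y]
    [Module R Y] (i : ℕ) : Function.Exact (pre f Y i) (δpre h Y i) :=
  (ShortComplex.ab_exact_iff_function_exact _).1
    (Abelian.Ext.contravariant_sequence_exact₁' h.shortExact (ModuleCat.of R Y) i (i + 1)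
      (add_comm 1 i))

lemma exact_δ_pre {f : A →ₗ[R] B} {g : B →ₗ[R] D} (h : IsSES f g) (Y : Type u) [AddCommGroup Y]
    [Module R Y] (i : ℕ) : Function.Exact (δpre h Y i) (pre g Y (i + 1)) :=
  (ShortComplex.ab_exact_iff_function_exact _).1
    (Abelian.Ext.contravariant_sequence_exact₃' h.shortExact (ModuleCat.of R Y) i (i + 1)
      (add_comm 1 i))

/-- Degree zero `Ext` is `Hom`. -/
def zeroEquiv (X Y : Type u) [AddCommGroup X] [Module R X] [AddCommGroup Y] [Module R Y] :
    ExtMod R X Y 0 ≃ₗ[R] (X →ₗ[R] Y) :=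
  (Abelian.Ext.linearEquiv₀ (R := R)).trans (ModuleCat.homLinearEquiv (S := R))

lemma zeroEquiv_symm (f : X →ₗ[R] Y) :
    (zeroEquiv X Y).symm f = Abelian.Ext.mk₀ (ModuleCat.ofHom f) := rfl

lemma zeroEquiv_post (f : Y →ₗ[R] Z) (x : ExtMod R X Y 0) :
    zeroEquiv X Z (post X f 0 x) = f.comp (zeroEquiv X Y x) := by
  obtain ⟨x, rfl⟩ := (zeroEquiv X Y).symm.surjective x
  rw [LinearEquiv.apply_symm_apply, ← LinearEquiv.eq_symm_apply, zeroEquiv_symm, zeroEquiv_symm,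
    post_apply, Abelian.Ext.mk₀_comp_mk₀]
  rfl

lemma zeroEquiv_pre (f : X →ₗ[R] Y) (x : ExtMod R Y Z 0) :
    zeroEquiv X Z (pre f Z 0 x) = (zeroEquiv Y Z x).comp f := by
  obtain ⟨x, rfl⟩ := (zeroEquiv Y Z).symm.surjective x
  rw [LinearEquiv.apply_symm_apply, ← LinearEquiv.eq_symm_apply, zeroEquiv_symm, zeroEquiv_symm,
    pre_apply, Abelian.Ext.mk₀_comp_mk₀]
  rfl

lemma post_comp (f : A →ₗ[R] B) (g : B →ₗ[R] D) (i : ℕ) (x : ExtMod R X A i) :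
    post X (g.comp f) i x = post X g i (post X f i x) := by
  simp only [post_apply, ModuleCat.ofHom_comp]
  rw [Abelian.Ext.comp_assoc_of_third_deg_zero, Abelian.Ext.mk₀_comp_mk₀]

lemma pre_comp (f : A →ₗ[R] B) (g : B →ₗ[R] D) (i : ℕ) (x : ExtMod R D X i) :
    pre (g.comp f) X i x = pre f X i (pre g X i x) := by
  simp only [pre_apply, ModuleCat.ofHom_comp, Abelian.Ext.mk₀_comp_mk₀_assoc]

lemma post_id (i : ℕ) (x : ExtMod R X A i) : post X LinearMap.id i x = x := by
  simp only [post_apply, ModuleCat.ofHom_id, Abelian.Ext.comp_mk₀_id]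

lemma pre_id (i : ℕ) (x : ExtMod R X A i) : pre LinearMap.id A i x = x := by
  simp only [pre_apply, ModuleCat.ofHom_id, Abelian.Ext.mk₀_id_comp]

lemma post_smul (r : R) (f : A →ₗ[R] B) (i : ℕ) (x : ExtMod R X A i) :
    post X (r • f) i x = r • post X f i x := by
  have h : ModuleCat.ofHom (r • f) = r • ModuleCat.ofHom f := rfl
  simp only [post_apply, h, Abelian.Ext.mk₀_smul, Abelian.Ext.comp_smul]

lemma pre_smul (r : R) (f : A →ₗ[R] B) (i : ℕ) (x : ExtMod R B X i) :
    pre (r • f) X i x = r • pre f X i x := by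
  have h : ModuleCat.ofHom (r • f) = r • ModuleCat.ofHom f := rfl
  simp only [pre_apply, h, Abelian.Ext.mk₀_smul, Abelian.Ext.smul_comp]

/-- Covariant functoriality on isomorphisms. -/
def postEquiv (X : Type u) [AddCommGroup X] [Module R X] (e : Y ≃ₗ[R] Z) (i : ℕ) :
    ExtMod R X Y i ≃ₗ[R] ExtMod R X Z i :=
  LinearEquiv.ofLinearMap (post X e.toLinearMap i) (post X e.symm.toLinearMap i)
    (by ext x; simp [← post_comp, post_id]) (by ext x; simp [← post_comp, post_id])

/-- Contravariant functoriality on isomorphisms. -/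
def preEquiv (e : X ≃ₗ[R] Y) (Z : Type u) [AddCommGroup Z] [Module R Z] (i : ℕ) :
    ExtMod R Y Z i ≃ₗ[R] ExtMod R X Z i :=
  LinearEquiv.ofLinearMap (pre e.toLinearMap Z i) (pre e.symm.toLinearMap Z i)
    (by ext x; simp [← pre_comp, pre_id]) (by ext x; simp [← pre_comp, pre_id])

end ExtMod

end ExtMod

section ExtVanishing

variable {R : Type u} [CommRing R]
variable {A B D : Type u} [AddCommGroup A] [Module R A] [AddCommGroup B] [Module R B]
  [AddCommGroup D] [Module R D]
  {X Y Z : Type u} [AddCommGroup X] [Module R X] [AddCommGroup Y] [Module R Y]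
  [AddCommGroup Z] [Module R Z]

lemma subsingleton_of_exact {P Q S : Type*} [Zero S] {f : P → Q} {g : Q → S}
    (h : Function.Exact f g) (hP : Subsingleton P) (hS : Subsingleton S) :
    Subsingleton Q := by
  refine ⟨fun x y => ?_⟩
  obtain ⟨a, rfl⟩ := (h x).1 (Subsingleton.elim _ _)
  obtain ⟨b, rfl⟩ := (h y).1 (Subsingleton.elim _ _)
  rw [Subsingleton.elim a b]

lemma injective_of_exact {P Q S : Type*} [AddCommGroup P] [Module R P] [AddCommGroup S]
    [Module R S] [AddCommGroup Q] [Module R Q] {f : P →ₗ[R] Q} {g : Q →ₗ[R] S}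
    (h : Function.Exact f g) (hP : Subsingleton P) : Function.Injective g := by
  rw [injective_iff_map_eq_zero]
  intro x hx
  obtain ⟨a, rfl⟩ := (h x).1 hx
  rw [Subsingleton.elim a 0, map_zero]

lemma surjective_of_exact {P Q S : Type*} [Zero S] {f : P → Q} {g : Q → S}
    (h : Function.Exact f g) (hS : Subsingleton S) : Function.Surjective f :=
  fun x => (h x).1 (Subsingleton.elim _ _)

namespace ExtMod

lemma van_post₁ (X : Type u) [AddCommGroup X] [Module R X] {f : A →ₗ[R] B} {g : B →ₗ[R] D}
    (h : IsSES f g) {i : ℕ} (h₁ : Subsingleton (ExtMod R X D i))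
    (h₂ : Subsingleton (ExtMod R X B (i + 1))) : Subsingleton (ExtMod R X A (i + 1)) :=
  subsingleton_of_exact (exact_δ_post X h i) h₁ h₂

lemma van_post₂ (X : Type u) [AddCommGroup X] [Module R X] {f : A →ₗ[R] B} {g : B →ₗ[R] D}
    (h : IsSES f g) {i : ℕ} (h₁ : Subsingleton (ExtMod R X A i))
    (h₂ : Subsingleton (ExtMod R X D i)) : Subsingleton (ExtMod R X B i) :=
  subsingleton_of_exact (exact_post X h i) h₁ h₂

lemma van_post₃ (X : Type u) [AddCommGroup X] [Module R X] {f : A →ₗ[R] B} {g : B →ₗ[R] D}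
    (h : IsSES f g) {i : ℕ} (h₁ : Subsingleton (ExtMod R X B i))
    (h₂ : Subsingleton (ExtMod R X A (i + 1))) : Subsingleton (ExtMod R X D i) :=
  subsingleton_of_exact (exact_post_δ X h i) h₁ h₂

lemma van_pre₃ {f : A →ₗ[R] B} {g : B →ₗ[R] D} (h : IsSES f g) (Y : Type u) [AddCommGroup Y]
    [Module R Y] {i : ℕ} (h₁ : Subsingleton (ExtMod R A Y i))
    (h₂ : Subsingleton (ExtMod R B Y (i + 1))) : Subsingleton (ExtMod R D Y (i + 1)) :=
  subsingleton_of_exact (exact_δ_pre h Y i) h₁ h₂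

lemma van_pre₂ {f : A →ₗ[R] B} {g : B →ₗ[R] D} (h : IsSES f g) (Y : Type u) [AddCommGroup Y]
    [Module R Y] {i : ℕ} (h₁ : Subsingleton (ExtMod R D Y i))
    (h₂ : Subsingleton (ExtMod R A Y i)) : Subsingleton (ExtMod R B Y i) :=
  subsingleton_of_exact (exact_pre h Y i) h₁ h₂

lemma van_pre₁ {f : A →ₗ[R] B} {g : B →ₗ[R] D} (h : IsSES f g) (Y : Type u) [AddCommGroup Y]
    [Module R Y] {i : ℕ} (h₁ : Subsingleton (ExtMod R B Y i))
    (h₂ : Subsingleton (ExtMod R D Y (i + 1))) : Subsingleton (ExtMod R A Y i) :=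
  subsingleton_of_exact (exact_pre_δ h Y i) h₁ h₂

/-- Covariant dimension shift. -/
def shiftPost (X : Type u) [AddCommGroup X] [Module R X] {f : A →ₗ[R] B} {g : B →ₗ[R] D}
    (h : IsSES f g) (i : ℕ) (h₁ : Subsingleton (ExtMod R X B i))
    (h₂ : Subsingleton (ExtMod R X B (i + 1))) :
    ExtMod R X D i ≃ₗ[R] ExtMod R X A (i + 1) :=
  LinearEquiv.ofBijective (δpost X h i)
    ⟨injective_of_exact (exact_post_δ X h i) h₁, surjective_of_exact (exact_δ_post X h i) h₂⟩

lemma van_congr (e : X ≃ₗ[R] Y) (e' : A ≃ₗ[R] B) {i : ℕ} (h : Subsingleton (ExtMod R X A i)) :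
    Subsingleton (ExtMod R Y B i) :=
  ((preEquiv e.symm A i).trans (postEquiv Y e' i)).symm.subsingleton

lemma van_post (X : Type u) [AddCommGroup X] [Module R X] (e' : A ≃ₗ[R] B) {i : ℕ}
    (h : Subsingleton (ExtMod R X A i)) : Subsingleton (ExtMod R X B i) :=
  (postEquiv X e' i).symm.subsingleton

lemma van_pre (e : X ≃ₗ[R] Y) (A : Type u) [AddCommGroup A] [Module R A] {i : ℕ}
    (h : Subsingleton (ExtMod R X A i)) : Subsingleton (ExtMod R Y A i) :=
  (preEquiv e.symm A i).symm.subsingleton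

lemma van_of_injective (X : Type u) [AddCommGroup X] [Module R X] (hY : Module.Injective R Y)
    (i : ℕ) : Subsingleton (ExtMod R X Y (i + 1)) := by
  have : CategoryTheory.Injective (ModuleCat.of R Y) :=
    Module.injective_object_of_injective_module R Y
  exact Abelian.Ext.subsingleton_of_injective _ _ i

lemma van_of_projective [Module.Projective R X] (Y : Type u) [AddCommGroup Y] [Module R Y]
    (i : ℕ) : Subsingleton (ExtMod R X Y (i + 1)) := by
  have : CategoryTheory.Projective (ModuleCat.of R X) :=
    (IsProjective.iff_projective X).1 inferInstance
  exact Abelian.Ext.subsingleton_of_projective _ _ i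

lemma van_of_subsingleton_left [Subsingleton X] (Y : Type u) [AddCommGroup Y] [Module R Y]
    (i : ℕ) : Subsingleton (ExtMod R X Y i) := by
  have h : (LinearMap.id : X →ₗ[R] X) = (0 : R) • LinearMap.id := Subsingleton.elim _ _
  refine (subsingleton_iff_forall_eq 0).2 fun x => ?_
  rw [← pre_id i x, h, pre_smul, zero_smul]

lemma van_of_subsingleton_right [Subsingleton Y] (X : Type u) [AddCommGroup X] [Module R X]
    (i : ℕ) : Subsingleton (ExtMod R X Y i) := by
  have h : (LinearMap.id : Y →ₗ[R] Y) = (0 : R) • LinearMap.id := Subsingleton.elim _ _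
  refine (subsingleton_iff_forall_eq 0).2 fun x => ?_
  rw [← post_id i x, h, post_smul, zero_smul]

lemma van_retract {f : A →ₗ[R] B} {g : B →ₗ[R] A} (h : g.comp f = LinearMap.id)
    (X : Type u) [AddCommGroup X] [Module R X] {i : ℕ} (hB : Subsingleton (ExtMod R X B i)) :
    Subsingleton (ExtMod R X A i) := by
  refine Function.Injective.subsingleton (f := post X f i) fun x y hxy => ?_
  rw [← post_id i x, ← h, post_comp, hxy, ← post_comp, h, post_id]

lemma lift_of_van {f : A →ₗ[R] B} {g : B →ₗ[R] D} (h : IsSES f g)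
    (hX : Subsingleton (ExtMod R X A 1)) (φ : X →ₗ[R] D) : ∃ ψ : X →ₗ[R] B, g.comp ψ = φ := by
  obtain ⟨y, hy⟩ := surjective_of_exact (exact_post_δ X h 0) hX ((zeroEquiv X D).symm φ)
  refine ⟨zeroEquiv X B y, ?_⟩
  rw [← zeroEquiv_post, hy, LinearEquiv.apply_symm_apply]

lemma extend_of_van {f : A →ₗ[R] B} {g : B →ₗ[R] D} (h : IsSES f g)
    (hY : Subsingleton (ExtMod R D Y 1)) (φ : A →ₗ[R] Y) : ∃ ψ : B →ₗ[R] Y, ψ.comp f = φ := by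
  obtain ⟨y, hy⟩ := surjective_of_exact (exact_pre_δ h Y 0) hY ((zeroEquiv A Y).symm φ)
  refine ⟨zeroEquiv B Y y, ?_⟩
  rw [← zeroEquiv_pre, hy, LinearEquiv.apply_symm_apply]

lemma van_one_of_lift {f : A →ₗ[R] B} {g : B →ₗ[R] D} (h : IsSES f g)
    (hB : Subsingleton (ExtMod R X B 1))
    (hl : ∀ φ : X →ₗ[R] D, ∃ ψ : X →ₗ[R] B, g.comp ψ = φ) : Subsingleton (ExtMod R X A 1) := by
  refine (subsingleton_iff_forall_eq 0).2 fun x => ?_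
  obtain ⟨y, rfl⟩ := surjective_of_exact (exact_δ_post X h 0) hB x
  obtain ⟨ψ, hψ⟩ := hl (zeroEquiv X D y)
  have : y = post X g 0 ((zeroEquiv X B).symm ψ) := by
    apply (zeroEquiv X D).injective
    rw [zeroEquiv_post, LinearEquiv.apply_symm_apply, hψ]
  rw [this, (exact_post_δ X h 0).apply_apply_eq_zero]

lemma van_one_of_extend {f : A →ₗ[R] B} {g : B →ₗ[R] D} (h : IsSES f g)
    (hB : Subsingleton (ExtMod R B Y 1))
    (hl : ∀ φ : A →ₗ[R] Y, ∃ ψ : B →ₗ[R] Y, ψ.comp f = φ) : Subsingleton (ExtMod R D Y 1) := by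
  refine (subsingleton_iff_forall_eq 0).2 fun x => ?_
  obtain ⟨y, rfl⟩ := surjective_of_exact (exact_δ_pre h Y 0) hB x
  obtain ⟨ψ, hψ⟩ := hl (zeroEquiv A Y y)
  have : y = pre f Y 0 ((zeroEquiv B Y).symm ψ) := by
    apply (zeroEquiv A Y).injective
    rw [zeroEquiv_pre, LinearEquiv.apply_symm_apply, hψ]
  rw [this, (exact_pre_δ h Y 0).apply_apply_eq_zero]

end ExtMod

lemma exists_injective_embedding (R : Type u) [CommRing R] (M : Type u) [AddCommGroup M]
    [Module R M] :
    ∃ (E : ModuleCat.{u} R) (f : M →ₗ[R] E), Module.Injective R E ∧ Function.Injective f := by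
  obtain ⟨⟨J, hJ, f, hf⟩⟩ := EnoughInjectives.presentation (ModuleCat.of R M)
  have : CategoryTheory.Injective (ModuleCat.of R J) := hJ
  exact ⟨J, f.hom, Module.injective_module_of_injective_object R J,
    (ModuleCat.mono_iff_injective _).1 hf⟩

lemma Module.Injective.of_equiv {E E' : Type u} [AddCommGroup E] [Module R E] [AddCommGroup E']
    [Module R E'] (e : E ≃ₗ[R] E') (h : Module.Injective R E) : Module.Injective R E' := by
  refine ⟨fun X Y _ _ _ _ f hf g => ?_⟩
  obtain ⟨k, hk⟩ := h.out f hf (e.symm.toLinearMap.comp g)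
  exact ⟨e.toLinearMap.comp k, fun x => by simp [hk]⟩

lemma Module.Injective.of_retract {E E' : Type u} [AddCommGroup E] [Module R E] [AddCommGroup E']
    [Module R E'] (i : E' →ₗ[R] E) (p : E →ₗ[R] E') (hp : ∀ x, p (i x) = x)
    (h : Module.Injective R E) : Module.Injective R E' := by
  refine ⟨fun X Y _ _ _ _ f hf g => ?_⟩
  obtain ⟨k, hk⟩ := h.out f hf (i.comp g)
  exact ⟨p.comp k, fun x => by simp [hk, hp]⟩

lemma Module.Injective.extend {E : Type u} [AddCommGroup E] [Module R E]
    (h : Module.Injective R E) (f : A →ₗ[R] B) (hf : Function.Injective f) (g : A →ₗ[R] E) :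
    ∃ k : B →ₗ[R] E, k.comp f = g := by
  obtain ⟨k, hk⟩ := h.out f hf g
  exact ⟨k, LinearMap.ext hk⟩

lemma injective_of_ext_quotient_van (M : Type u) [AddCommGroup M] [Module R M]
    (h : ∀ I : Ideal R, Subsingleton (ExtMod R (R ⧸ I) M 1)) : Module.Injective R M := by
  refine Module.Baer.injective fun I g => ?_
  have hs : IsSES (I.subtype : I →ₗ[R] R) (Submodule.mkQ I) :=
    ⟨Subtype.val_injective, fun x => by simp [Ideal.Quotient.eq_zero_iff_mem],
      Submodule.mkQ_surjective _⟩
  obtain ⟨ψ, hψ⟩ := ExtMod.extend_of_van hs (h I) g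
  exact ⟨ψ, fun x hx => LinearMap.congr_fun hψ ⟨x, hx⟩⟩

end ExtVanishing

section OppositeComplex

variable {R : Type u} [CommRing R] (K : ChainComplex (ModuleCat.{u} R)ᵒᵖ ℕ) (n : ℕ)

/-- The relation between cocycles and the homology classes they represent, for chain complexes
in the opposite of the category of modules. -/
def homologyRel : Submodule R ((K.X n).unop × (K.homology n).unop) :=
  LinearMap.range (((K.pOpcycles n).unop.hom).prod ((K.homologyι n).unop.hom))

variable {K n}

lemma mem_homologyRel {f : (K.X n).unop} {z : (K.homology n).unop} :
    (f, z) ∈ homologyRel K n ↔ ∃ o : (K.opcycles n).unop,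
      (K.pOpcycles n).unop.hom o = f ∧ (K.homologyι n).unop.hom o = z := by
  simp [homologyRel]

lemma pOpcycles_unop_injective : Function.Injective (K.pOpcycles n).unop.hom :=
  (ModuleCat.mono_iff_injective _).1 inferInstance

lemma homologyι_unop_surjective : Function.Surjective (K.homologyι n).unop.hom :=
  (ModuleCat.epi_iff_surjective _).1 inferInstance

lemma homologyRel_surj (z : (K.homology n).unop) : ∃ f, (f, z) ∈ homologyRel K n := by
  obtain ⟨o, ho⟩ := homologyι_unop_surjective z
  exact ⟨_, mem_homologyRel.2 ⟨o, rfl, ho⟩⟩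

lemma homologyRel_cocycle {f : (K.X n).unop} {z : (K.homology n).unop}
    (h : (f, z) ∈ homologyRel K n) (m : ℕ) : (K.d m n).unop.hom f = 0 := by
  obtain ⟨o, rfl, -⟩ := mem_homologyRel.1 h
  have : (K.d m n ≫ K.pOpcycles n).unop.hom o = 0 := by
    rw [K.d_pOpcycles]; rfl
  exact this

lemma homologyRel_zero {z : (K.homology n).unop} (h : ((0 : (K.X n).unop), z) ∈ homologyRel K n) :
    z = 0 := by
  obtain ⟨o, ho, rfl⟩ := mem_homologyRel.1 h
  rw [(map_eq_zero_iff _ pOpcycles_unop_injective).1 ho, map_zero]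

lemma exists_homologyRel {f : (K.X n).unop} (h : (K.d (n + 1) n).unop.hom f = 0) :
    ∃ z, (f, z) ∈ homologyRel K n := by
  let φ : ModuleCat.of R R ⟶ (K.X n).unop := ModuleCat.ofHom (LinearMap.toSpanSingleton R _ f)
  have hφ : K.d (n + 1) n ≫ φ.op = 0 := by
    apply Quiver.Hom.unop_inj
    ext
    simpa [φ] using h
  let o := (K.descOpcycles φ.op (n + 1) (by simp) hφ).unop.hom (1 : R)
  have ho : (K.pOpcycles n).unop.hom o = f := by
    have := K.p_descOpcycles φ.op (n + 1) (by simp) hφ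
    have h2 : (K.pOpcycles n ≫ K.descOpcycles φ.op (n + 1) (by simp) hφ).unop.hom (1 : R) =
      φ.hom (1 : R) := by rw [this]; rfl
    exact h2.trans (one_smul R f)
  exact ⟨_, mem_homologyRel.2 ⟨o, ho, rfl⟩⟩

lemma homologyRel_boundary (m : ℕ) (g : (K.X m).unop) :
    ((K.d n m).unop.hom g, (0 : (K.homology n).unop)) ∈ homologyRel K n := by
  refine mem_homologyRel.2 ⟨(K.fromOpcycles n m).unop.hom g, ?_, ?_⟩
  · have : (K.pOpcycles n ≫ K.fromOpcycles n m).unop.hom g = (K.d n m).unop.hom g := by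
      rw [K.p_fromOpcycles]
    exact this
  · have : (K.homologyι n ≫ K.fromOpcycles n m).unop.hom g = 0 := by
      rw [K.homologyι_comp_fromOpcycles]; rfl
    exact this

lemma exists_boundary_of_homologyRel {m : ℕ} (hm : m + 1 = n) {f : (K.X n).unop}
    (h : (f, (0 : (K.homology n).unop)) ∈ homologyRel K n) :
    ∃ g : (K.X m).unop, (K.d n m).unop.hom g = f := by
  obtain ⟨o, rfl, ho⟩ := mem_homologyRel.1 h
  have hex : (ShortComplex.mk _ _ (K.homologyι_comp_fromOpcycles n m)).Exact :=
    ShortComplex.exact_of_f_is_kernel _ (K.homologyIsKernel n m (by simp [← hm]))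
  have := (ShortComplex.ShortExact.moduleCat_exact_iff_function_exact _).1 hex.unop
  obtain ⟨g, hg⟩ := (this o).1 ho
  refine ⟨g, ?_⟩
  have h2 : (K.pOpcycles n ≫ K.fromOpcycles n m).unop.hom g = (K.d n m).unop.hom g := by
    rw [K.p_fromOpcycles]
  exact h2.symm.trans (congrArg (K.pOpcycles n).unop.hom hg)

lemma eq_zero_of_homologyRel_zero {K : ChainComplex (ModuleCat.{u} R)ᵒᵖ ℕ} {f : (K.X 0).unop}
    (h : (f, (0 : (K.homology 0).unop)) ∈ homologyRel K 0) : f = 0 := by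
  obtain ⟨o, rfl, ho⟩ := mem_homologyRel.1 h
  have : Function.Injective (K.homologyι 0).unop.hom :=
    (ModuleCat.mono_iff_injective _).1 inferInstance
  rw [(map_eq_zero_iff _ this).1 ho, map_zero]

lemma homologyRel_map {L : ChainComplex (ModuleCat.{u} R)ᵒᵖ ℕ} (φ : K ⟶ L) {f : (L.X n).unop}
    {z : (L.homology n).unop} (h : (f, z) ∈ homologyRel L n) :
    ((φ.f n).unop.hom f, (HomologicalComplex.homologyMap φ n).unop.hom z) ∈ homologyRel K n := by
  obtain ⟨o, rfl, rfl⟩ := mem_homologyRel.1 h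
  refine mem_homologyRel.2 ⟨(HomologicalComplex.opcyclesMap φ n).unop.hom o, ?_, ?_⟩
  · have := congrArg (fun k => k.unop.hom o) (HomologicalComplex.p_opcyclesMap φ n)
    exact this
  · have := congrArg (fun k => k.unop.hom o) (HomologicalComplex.homologyι_naturality φ n)
    exact this.symm

end OppositeComplex

section ExtComparison

variable {R : Type u} [CommRing R]

/-- The linear equivalence defined by a linear bijective relation. -/
def LinearEquiv.ofRel {U V : Type*} [AddCommGroup U] [Module R U] [AddCommGroup V] [Module R V]
    (S : Submodule R (U × V)) (h₁ : ∀ u, ∃ v, (u, v) ∈ S) (h₂ : ∀ v, ∃ u, (u, v) ∈ S)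
    (h₃ : ∀ v, ((0 : U), v) ∈ S → v = 0) (h₄ : ∀ u, (u, (0 : V)) ∈ S → u = 0) : U ≃ₗ[R] V :=
  (LinearEquiv.ofBijective ((LinearMap.fst R U V).comp S.subtype) ⟨by
      rw [injective_iff_map_eq_zero]
      rintro ⟨⟨u, v⟩, h⟩ (rfl : u = 0)
      simp [h₃ v h], fun u => by
      obtain ⟨v, hv⟩ := h₁ u
      exact ⟨⟨_, hv⟩, rfl⟩⟩).symm.trans
  (LinearEquiv.ofBijective ((LinearMap.snd R U V).comp S.subtype) ⟨by
      rw [injective_iff_map_eq_zero]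
      rintro ⟨⟨u, v⟩, h⟩ (rfl : v = 0)
      simp [h₄ u h], fun v => by
      obtain ⟨u, hu⟩ := h₂ v
      exact ⟨⟨_, hu⟩, rfl⟩⟩)

lemma LinearEquiv.ofRel_eq {U V : Type*} [AddCommGroup U] [Module R U] [AddCommGroup V]
    [Module R V] (S : Submodule R (U × V)) (h₁ : ∀ u, ∃ v, (u, v) ∈ S) (h₂ : ∀ v, ∃ u, (u, v) ∈ S)
    (h₃ : ∀ v, ((0 : U), v) ∈ S → v = 0) (h₄ : ∀ u, (u, (0 : V)) ∈ S → u = 0) {u : U} {v : V}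
    (h : (u, v) ∈ S) : LinearEquiv.ofRel S h₁ h₂ h₃ h₄ u = v := by
  rw [LinearEquiv.ofRel, LinearEquiv.trans_apply]
  have key (e : S ≃ₗ[R] U) (he : e ⟨_, h⟩ = u) : e.symm u = ⟨_, h⟩ :=
    e.symm_apply_eq.2 he.symm
  rw [key _ rfl]
  rfl

variable {X : ModuleCat.{u} R} (P : ProjectiveResolution X) (M : ModuleCat.{u} R)

/-- The complex of linear maps from a projective resolution to a module, in the opposite
category. -/
abbrev homComplex : ChainComplex (ModuleCat.{u} R)ᵒᵖ ℕ :=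
  (((linearYoneda R (ModuleCat.{u} R)).obj M).rightOp.mapHomologicalComplex _).obj P.complex

/-- The homology class corresponding to an element of `Ext`. -/
def oldExtEquiv (n : ℕ) : ((Ext R (ModuleCat.{u} R) n).obj (Opposite.op X)).obj M ≃ₗ[R]
    ((homComplex P M).homology n).unop :=
  (P.isoLeftDerivedObj ((linearYoneda R (ModuleCat.{u} R)).obj M).rightOp n).symm.unop.toLinearEquiv

lemma extMk_zero_injective {Y : ModuleCat.{u} R} (f : P.complex.X 0 ⟶ Y)
    (hf : P.complex.d 1 0 ≫ f = 0) (h : P.extMk f 1 rfl hf = 0) : f = 0 := by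
  simp only [← P.extEquivCohomologyClass.apply_eq_iff_eq,
    P.extEquivCohomologyClass_extMk, P.extEquivCohomologyClass_zero,
    CochainComplex.HomComplex.CohomologyClass.mk_eq_zero_iff] at h
  rw [CochainComplex.HomComplex.Cocycle.toSingleMk_mem_coboundaries_iff _ _ _ _ _ 1 (by lia)] at h
  obtain ⟨g, hg⟩ := h
  have hz : Limits.IsZero (P.cochainComplex.X 1) := by
    exact CochainComplex.isZero_of_isStrictlyLE _ 0 _
  rw [hz.eq_of_src g 0, Limits.comp_zero] at hg
  rw [← cancel_epi (P.cochainComplexXIso (-0) 0 rfl).hom]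
  exact hg.symm.trans Limits.comp_zero.symm

lemma smul_extMk {Y : ModuleCat.{u} R} {n : ℕ} (r : R) (f : P.complex.X n ⟶ Y)
    (hf : P.complex.d (n + 1) n ≫ f = 0) :
    r • P.extMk f (n + 1) rfl hf = P.extMk (r • f) (n + 1) rfl (by simp [hf]) := by
  rw [Abelian.Ext.smul_eq_comp_mk₀, P.extMk_comp_mk₀]
  congr 1

/-- A cocycle represents a class in the first definition of `Ext`. -/
def ExtRep (n : ℕ) (f : P.complex.X n ⟶ M)
    (z : ((Ext R (ModuleCat.{u} R) n).obj (Opposite.op X)).obj M) : Prop :=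
  ((show ((homComplex P M).X n).unop from f), oldExtEquiv P M n z) ∈
    homologyRel (homComplex P M) n

variable {P M} in
lemma ExtRep.add {n : ℕ} {f g : P.complex.X n ⟶ M}
    {z w : ((Ext R (ModuleCat.{u} R) n).obj (Opposite.op X)).obj M}
    (h : ExtRep P M n f z) (h' : ExtRep P M n g w) : ExtRep P M n (f + g) (z + w) := by
  rw [ExtRep, map_add]
  exact Submodule.add_mem _ h h'

variable {P M} in
lemma ExtRep.smul {n : ℕ} {f : P.complex.X n ⟶ M}
    {z : ((Ext R (ModuleCat.{u} R) n).obj (Opposite.op X)).obj M}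
    (h : ExtRep P M n f z) (r : R) : ExtRep P M n (r • f) (r • z) := by
  rw [ExtRep, map_smul]
  exact Submodule.smul_mem _ r h

variable {P M} in
lemma ExtRep.eq_zero_of_boundary {m : ℕ} (g : P.complex.X m ⟶ M)
    {z : ((Ext R (ModuleCat.{u} R) (m + 1)).obj (Opposite.op X)).obj M}
    (h : ExtRep P M (m + 1) (P.complex.d (m + 1) m ≫ g) z) : z = 0 := by
  apply (oldExtEquiv P M (m + 1)).injective
  rw [map_zero]
  have h2 := homologyRel_boundary (K := homComplex P M) (n := m + 1) m g
  refine homologyRel_zero ?_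
  have h3 := Submodule.sub_mem _ h h2
  refine (congrArg (· ∈ homologyRel (homComplex P M) (m + 1)) ?_).mp h3
  exact Prod.ext (sub_self _) (sub_zero _)

/-- The comparison relation between the two definitions of `Ext`. -/
def extRel (n : ℕ) : Submodule R (((Ext R (ModuleCat.{u} R) n).obj (Opposite.op X)).obj M ×
    Abelian.Ext X M n) where
  carrier := {zx | ∃ (f : P.complex.X n ⟶ M) (hf : P.complex.d (n + 1) n ≫ f = 0),
    ExtRep P M n f zx.1 ∧
      P.extMk f (n + 1) rfl hf = zx.2}
  add_mem' := by
    rintro ⟨z, x⟩ ⟨z', x'⟩ ⟨f, hf, h, rfl⟩ ⟨f', hf', h', rfl⟩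
    refine ⟨f + f', by simp [hf, hf'], h.add h', (P.add_extMk _ _ _ _ hf hf').symm⟩
  zero_mem' := ⟨0, by simp, by
    rw [ExtRep, Prod.fst_zero, map_zero]
    exact Submodule.zero_mem _, by simp⟩
  smul_mem' := by
    rintro r ⟨z, x⟩ ⟨f, hf, h, rfl⟩
    refine ⟨r • f, by simp [hf], h.smul r, (smul_extMk _ _ _ hf).symm⟩

/-- The comparison between the two definitions of `Ext`. -/
def extComparison (n : ℕ) : ((Ext R (ModuleCat.{u} R) n).obj (Opposite.op X)).obj M ≃ₗ[R]
    Abelian.Ext X M n :=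
  LinearEquiv.ofRel (extRel P M n)
    (fun z => by
      obtain ⟨f, hf⟩ := homologyRel_surj (oldExtEquiv P M n z)
      exact ⟨_, f, homologyRel_cocycle hf (n + 1), hf, rfl⟩)
    (fun x => by
      obtain ⟨f, hf, rfl⟩ := P.extMk_surjective x (n + 1) rfl
      obtain ⟨z, hz⟩ := exists_homologyRel (K := homComplex P M) (n := n) (f := f) hf
      exact ⟨(oldExtEquiv P M n).symm z, f, hf, by rw [ExtRep, LinearEquiv.apply_symm_apply]; exact hz, rfl⟩)
    (by
      rintro x ⟨f, hf, h, rfl⟩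
      rw [ExtRep, map_zero] at h
      cases n with
      | zero =>
        obtain rfl : f = 0 := eq_zero_of_homologyRel_zero h
        simp
      | succ m =>
        obtain ⟨g, hg⟩ := exists_boundary_of_homologyRel rfl h
        exact (P.extMk_eq_zero_iff f _ rfl hf m rfl).2 ⟨g, hg⟩)
    (by
      rintro z ⟨f, hf, h, hx⟩
      cases n with
      | zero =>
        obtain rfl : f = 0 := extMk_zero_injective P f hf hx
        exact (oldExtEquiv P M 0).injective ((homologyRel_zero h).trans (map_zero _).symm)
      | succ m =>
        obtain ⟨g, rfl⟩ := (P.extMk_eq_zero_iff f _ rfl hf m rfl).1 hx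
        exact h.eq_zero_of_boundary)

lemma extComparison_eq {n : ℕ} {z : ((Ext R (ModuleCat.{u} R) n).obj (Opposite.op X)).obj M}
    {x : Abelian.Ext X M n} (h : (z, x) ∈ extRel P M n) : extComparison P M n z = x :=
  LinearEquiv.ofRel_eq _ _ _ _ _ h

lemma ExtRep.map {X' : ModuleCat.{u} R} {P' : ProjectiveResolution X'} {P M} {g : X' ⟶ X}
    (φ : ProjectiveResolution.Hom P' P g) {n : ℕ} {f : P.complex.X n ⟶ M}
    {z : ((Ext R (ModuleCat.{u} R) n).obj (Opposite.op X)).obj M} (h : ExtRep P M n f z) :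
    ExtRep P' M n (φ.hom.f n ≫ f) ((((Ext R (ModuleCat.{u} R) n).map g.op).app M).hom z) := by
  have h2 := homologyRel_map ((((linearYoneda R (ModuleCat.{u} R)).obj M).rightOp.mapHomologicalComplex
    _).map φ.hom) h
  have h3 := ProjectiveResolution.isoLeftDerivedObj_inv_naturality g P' P φ.hom
    (φ.hom_f_zero_comp_π_f_zero.trans (congrArg (P'.π.f 0 ≫ ·) (by simp)))
    ((linearYoneda R (ModuleCat.{u} R)).obj M).rightOp n
  have h4 := congrArg (fun q => q.unop.hom z) h3
  rw [ExtRep]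
  exact (congrArg (fun w => ((show ((homComplex P' M).X n).unop from φ.hom.f n ≫ f), w) ∈
    homologyRel (homComplex P' M) n) h4.symm).mp h2

lemma extComparison_naturality {X' : ModuleCat.{u} R} (P' : ProjectiveResolution X') (g : X' ⟶ X)
    (n : ℕ) (z : ((Ext R (ModuleCat.{u} R) n).obj (Opposite.op X)).obj M) :
    extComparison P' M n ((((Ext R (ModuleCat.{u} R) n).map g.op).app M).hom z) =
      (Abelian.Ext.mk₀ g).comp (extComparison P M n z) (zero_add n) := by
  obtain ⟨f, hf⟩ : ∃ f : P.complex.X n ⟶ M, ExtRep P M n f z :=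
    homologyRel_surj (oldExtEquiv P M n z)
  have hf' : P.complex.d (n + 1) n ≫ f = 0 := homologyRel_cocycle hf (n + 1)
  let φ : ProjectiveResolution.Hom P' P g := ⟨ProjectiveResolution.lift g P' P, by
    exact congrArg (·.f 0) (ProjectiveResolution.lift_commutes g P' P)⟩
  have h1 : extComparison P M n z = P.extMk f (n + 1) rfl hf' :=
    extComparison_eq P M ⟨f, hf', hf, rfl⟩
  rw [h1, P.mk₀_comp_extMk _ _ _ _ φ]
  have h2 : P'.complex.d (n + 1) n ≫ φ.hom.f n ≫ f = 0 := by
    rw [← φ.hom.comm_assoc, hf', Limits.comp_zero]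
  exact extComparison_eq _ _ ⟨_, h2, ExtRep.map φ hf, rfl⟩

end ExtComparison

section LocalCohomologyColimit

variable {R : Type u} [CommRing R]

/-- The transition maps between quotients by powers of an ideal. -/
def powQuot (a : Ideal R) {t s : ℕ} (h : t ≤ s) : (R ⧸ a ^ s) →ₗ[R] (R ⧸ a ^ t) :=
  Submodule.mapQ _ _ LinearMap.id (Ideal.pow_le_pow_right h : a ^ s ≤ a ^ t)

/-- `T` is the colimit of the modules `Ext^i(R / a ^ t, M)`. -/
def IsLC (a : Ideal R) (i : ℕ) (M T : Type u) [AddCommGroup M] [Module R M] [AddCommGroup T]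
    [Module R T] : Prop :=
  ∃ ι : ∀ t : ℕ, ExtMod R (R ⧸ a ^ t) M i →ₗ[R] T,
    (∀ (t s : ℕ) (h : t ≤ s) (x : ExtMod R (R ⧸ a ^ t) M i),
      ι s (ExtMod.pre (powQuot a h) M i x) = ι t x) ∧
    (∀ z, ∃ t x, ι t x = z) ∧
    (∀ t x, ι t x = 0 → ∃ (s : ℕ) (h : t ≤ s), ExtMod.pre (powQuot a h) M i x = 0)

/-- The colimit of the modules `Ext^i(R / a ^ t, M)` vanishes. -/
def LCVanish (a : Ideal R) (i : ℕ) (M : Type u) [AddCommGroup M] [Module R M] : Prop :=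
  ∀ t (x : ExtMod R (R ⧸ a ^ t) M i),
    ∃ (s : ℕ) (h : t ≤ s), ExtMod.pre (powQuot a h) M i x = 0

lemma IsLC.subsingleton_iff {a : Ideal R} {i : ℕ} {M T : Type u} [AddCommGroup M] [Module R M]
    [AddCommGroup T] [Module R T] (h : IsLC a i M T) : Subsingleton T ↔ LCVanish a i M := by
  obtain ⟨ι, h1, h2, h3⟩ := h
  refine ⟨fun _ t x => h3 t x (Subsingleton.elim _ _), fun h => ?_⟩
  refine subsingleton_of_forall_eq 0 fun z => ?_
  obtain ⟨t, x, rfl⟩ := h2 z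
  obtain ⟨s, hs, h0⟩ := h t x
  rw [← h1 t s hs, h0, map_zero]

lemma exists_map_eq_zero_of_isColimit (G : (ℕᵒᵖ)ᵒᵖ ⥤ ModuleCat.{u} R) {c : Limits.Cocone G}
    (hc : Limits.IsColimit c) (t : ℕ) (z : G.obj (.op (.op t)))
    (hz : (c.ι.app (.op (.op t))).hom z = 0) :
    ∃ (s : ℕ) (h : t ≤ s), (G.map (homOfLE h).op.op).hom z = 0 := by
  have : Limits.PreservesFilteredColimitsOfSize.{0, 0} (forget (ModuleCat.{u} R)) :=
    Limits.preservesFilteredColimitsOfSize_shrink.{0, u, 0, u} _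
  obtain ⟨k, f, g, hfg⟩ := Limits.Concrete.isColimit_exists_of_rep_eq _
    (i := .op (.op t)) (j := .op (.op t)) hc z 0 (hz.trans (map_zero _).symm)
  exact ⟨k.unop.unop, leOfHom f.unop.unop, hfg.trans (map_zero _)⟩

theorem isLC_localCohomology (a : Ideal R) (i : ℕ) (M : ModuleCat.{u} R) :
    IsLC a i M ((localCohomology a i).obj M) := by
  let F := localCohomology.diagram (localCohomology.idealPowersDiagram a) i
  have : Limits.HasColimit F := localCohomology.hasColimitDiagram _ i
  let Fc : Limits.Cocone (F ⋙ (evaluation _ _).obj M) :=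
    ((evaluation (ModuleCat.{u} R) (ModuleCat.{u} R)).obj M).mapCocone (Limits.colimit.cocone F)
  have hc : Limits.IsColimit Fc :=
    Limits.isColimitOfPreserves ((evaluation _ _).obj M) (Limits.colimit.isColimit F)
  have : Limits.PreservesFilteredColimitsOfSize.{0, 0} (forget (ModuleCat.{u} R)) :=
    Limits.preservesFilteredColimitsOfSize_shrink.{0, u, 0, u} _
  let P (t : ℕ) := projectiveResolution (ModuleCat.of R (R ⧸ a ^ t))
  let e (t : ℕ) := extComparison (P t) M i
  let j (t : ℕ) : (((Ext R (ModuleCat.{u} R) i).obj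
      (Opposite.op (ModuleCat.of R (R ⧸ a ^ t)))).obj M) →ₗ[R] ((localCohomology a i).obj M) :=
    (Fc.ι.app (Opposite.op (Opposite.op t))).hom
  let φ {t s : ℕ} (h : t ≤ s) := ((((Ext R (ModuleCat.{u} R) i).map
      (ModuleCat.ofHom (powQuot a h)).op).app M).hom)
  have hj : ∀ {t s : ℕ} (h : t ≤ s) z, j s (φ h z) = j t z := fun {t s} h z =>
    congrArg (fun q => q.hom z) (Fc.w (homOfLE h).op.op)
  have nat : ∀ {t s : ℕ} (h : t ≤ s) z, e s (φ h z) = ExtMod.pre (powQuot a h) M i (e t z) :=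
    fun {t s} h z => extComparison_naturality (P t) M (P s) (ModuleCat.ofHom (powQuot a h)) i z
  refine ⟨fun t => (j t).comp (e t).symm.toLinearMap, fun t s h x => ?_, fun z => ?_,
    fun t x hx => ?_⟩
  · obtain ⟨z, rfl⟩ := (e t).surjective x
    rw [← nat]
    simp [hj]
  · obtain ⟨k, y, hy⟩ := Limits.Concrete.isColimit_exists_rep _ hc z
    exact ⟨k.unop.unop, e _ y, (congrArg (j _) ((e _).symm_apply_apply y)).trans hy⟩
  · obtain ⟨z, rfl⟩ := (e t).surjective x
    have hz : j t z = j t 0 := by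
      rw [map_zero, ← hx]
      exact congrArg (j t) ((e t).symm_apply_apply z).symm
    obtain ⟨s, h, h0⟩ := exists_map_eq_zero_of_isColimit _ hc t z (hz.trans (map_zero _))
    have h1 : φ h z = 0 := h0
    exact ⟨s, h, by rw [← nat, h1, map_zero]⟩

lemma ExtMod.subsingleton_of_ext {M N : ModuleCat.{u} R} {i : ℕ}
    (h : Subsingleton (((Ext R (ModuleCat.{u} R) i).obj (Opposite.op M)).obj N)) :
    Subsingleton (ExtMod R M N i) :=
  (extComparison (projectiveResolution M) N i).symm.toEquiv.subsingleton

end LocalCohomologyColimit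

section PowerTorsion

variable {R : Type u} [CommRing R]

lemma ExtMod.δpost_post {A B D A' B' D' : Type u} [AddCommGroup A] [Module R A] [AddCommGroup B]
    [Module R B] [AddCommGroup D] [Module R D] [AddCommGroup A'] [Module R A'] [AddCommGroup B']
    [Module R B'] [AddCommGroup D'] [Module R D'] (X : Type u) [AddCommGroup X] [Module R X]
    {f : A →ₗ[R] B} {g : B →ₗ[R] D} (h : IsSES f g) {f' : A' →ₗ[R] B'} {g' : B' →ₗ[R] D'}
    (h' : IsSES f' g') (a : A →ₗ[R] A') (b : B →ₗ[R] B') (d : D →ₗ[R] D')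
    (ha : f'.comp a = b.comp f) (hb : g'.comp b = d.comp g) (i : ℕ) (x : ExtMod R X D i) :
    δpost X h' i (post X d i x) = post X a (i + 1) (δpost X h i x) := by
  let φ : h.sc ⟶ h'.sc :=
    { τ₁ := ModuleCat.ofHom a
      τ₂ := ModuleCat.ofHom b
      τ₃ := ModuleCat.ofHom d
      comm₁₂ := by ext y; exact LinearMap.congr_fun ha y
      comm₂₃ := by ext y; exact LinearMap.congr_fun hb y }
  have h1 := Abelian.Ext.comp_assoc_of_second_deg_zero x (Abelian.Ext.mk₀ (ModuleCat.ofHom d))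
    h'.shortExact.extClass (a₁₃ := i + 1) rfl
  have h2 := Abelian.Ext.comp_assoc_of_third_deg_zero x h.shortExact.extClass
    (Abelian.Ext.mk₀ (ModuleCat.ofHom a)) (a₁₂ := i + 1) rfl
  have h3 := ShortComplex.ShortExact.extClass_naturality h.shortExact h'.shortExact φ
  refine h1.trans (Eq.trans ?_ h2.symm)
  exact congrArg (fun y => x.comp y rfl) h3.symm

/-- The submodule of elements killed by some power of an ideal. -/
def powTorsion (a : Ideal R) (M : Type u) [AddCommGroup M] [Module R M] : Submodule R M where
  carrier := {x | ∃ t : ℕ, ∀ r ∈ a ^ t, r • x = 0}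
  add_mem' := by
    rintro x y ⟨t, ht⟩ ⟨s, hs⟩
    refine ⟨max t s, fun r hr => ?_⟩
    rw [smul_add, ht r (Ideal.pow_le_pow_right (le_max_left _ _) hr),
      hs r (Ideal.pow_le_pow_right (le_max_right _ _) hr), add_zero]
  zero_mem' := ⟨0, fun r _ => smul_zero r⟩
  smul_mem' := by
    rintro c x ⟨t, ht⟩
    exact ⟨t, fun r hr => by rw [smul_comm, ht r hr, smul_zero]⟩

/-- A module killed by a power of an ideal. -/
def IsPowTorsion (a : Ideal R) (N : Type u) [AddCommGroup N] [Module R N] : Prop :=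
  ∃ s : ℕ, ∀ r ∈ a ^ s, ∀ x : N, r • x = 0

lemma isPowTorsion_quotient_pow (a : Ideal R) (t : ℕ) : IsPowTorsion a (R ⧸ a ^ t) := by
  refine ⟨t, fun r hr x => ?_⟩
  obtain ⟨x, rfl⟩ := Ideal.Quotient.mk_surjective x
  rw [← Ideal.Quotient.mk_eq_mk, ← Submodule.Quotient.mk_smul, Submodule.Quotient.mk_eq_zero]
  exact Ideal.mul_mem_right _ _ hr

lemma Module.Injective.extend_of_ker_le {A B E : Type u} [AddCommGroup A] [Module R A]
    [AddCommGroup B] [Module R B] [AddCommGroup E] [Module R E]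
    (h : Module.Injective R E) (f : A →ₗ[R] B) (g : A →ₗ[R] E)
    (hk : LinearMap.ker f ≤ LinearMap.ker g) : ∃ k : B →ₗ[R] E, k.comp f = g := by
  obtain ⟨k, hk'⟩ := h.extend ((LinearMap.ker f).liftQ f le_rfl)
    (LinearMap.ker_eq_bot.1 (Submodule.ker_liftQ_eq_bot _ _ _ le_rfl)) ((LinearMap.ker f).liftQ g hk)
  refine ⟨k, ?_⟩
  ext x
  exact LinearMap.congr_fun hk' (Submodule.Quotient.mk x)

lemma exists_pow_smul_eq_zero_of_fg {a : Ideal R} {M : Type u} [AddCommGroup M] [Module R M]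
    {N : Submodule R M} (hN : N.FG) (h : N ≤ powTorsion a M) :
    ∃ t : ℕ, ∀ r ∈ a ^ t, ∀ x ∈ N, r • x = 0 := by
  induction N, hN using Submodule.fg_induction with
  | singleton x =>
    obtain ⟨t, ht⟩ := h (Submodule.mem_span_singleton_self x)
    refine ⟨t, fun r hr y hy => ?_⟩
    obtain ⟨c, rfl⟩ := Submodule.mem_span_singleton.1 hy
    rw [smul_comm, ht r hr, smul_zero]
  | sup N₁ N₂ _ _ h₁ h₂ =>
    obtain ⟨t, ht⟩ := h₁ (le_sup_left.trans h)
    obtain ⟨s, hs⟩ := h₂ (le_sup_right.trans h)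
    refine ⟨max t s, fun r hr y hy => ?_⟩
    obtain ⟨y, hy', z, hz, rfl⟩ := Submodule.mem_sup.1 hy
    rw [smul_add, ht r (Ideal.pow_le_pow_right (le_max_left _ _) hr) _ hy',
      hs r (Ideal.pow_le_pow_right (le_max_right _ _) hr) _ hz, add_zero]

/-- Over a Noetherian ring, the torsion submodule of an injective module is injective. -/
theorem Module.Injective.powTorsion [IsNoetherianRing R] (a : Ideal R) {E : Type u}
    [AddCommGroup E] [Module R E] (hE : Module.Injective R E) :
    Module.Injective R (powTorsion a E) := by
  refine Module.Baer.injective fun I g => ?_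
  obtain ⟨t, ht⟩ := exists_pow_smul_eq_zero_of_fg (a := a)
    (N := LinearMap.range ((_root_.powTorsion a E).subtype.comp g))
    (by
      rw [LinearMap.range_eq_map]
      exact Submodule.FG.map _ ((Module.finite_def).1 inferInstance)) (by
    rintro _ ⟨x, rfl⟩
    exact (g x).2)
  obtain ⟨k, hk⟩ := Ideal.exists_pow_inf_eq_pow_smul a (M := R) I
  obtain ⟨φ, hφ⟩ := hE.extend_of_ker_le ((Submodule.mkQ (a ^ (k + t))).comp I.subtype)
    ((_root_.powTorsion a E).subtype.comp g) (by
      rintro ⟨x, hx⟩ h0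
      have h1 : x ∈ a ^ (k + t) := (Submodule.Quotient.mk_eq_zero _).1 h0
      have h2 : x ∈ a ^ (k + t) • (⊤ : Submodule R R) ⊓ I :=
        ⟨by simpa using h1, hx⟩
      rw [hk _ (Nat.le_add_right _ _), Nat.add_sub_cancel_left] at h2
      have h3 : x ∈ a ^ t • I := Submodule.smul_mono le_rfl inf_le_right h2
      have h4 : a ^ t • I ≤ (LinearMap.ker ((_root_.powTorsion a E).subtype.comp g)).map I.subtype := by
        refine Submodule.smul_le.2 fun r hr y hy => ⟨r • ⟨y, hy⟩, ?_, rfl⟩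
        rw [SetLike.mem_coe, LinearMap.mem_ker, map_smul]
        exact ht r hr _ ⟨_, rfl⟩
      obtain ⟨y, hy, rfl⟩ := h4 h3
      exact hy)
  have hmem (x : R) : φ (Submodule.Quotient.mk x) ∈ _root_.powTorsion a E := by
    refine ⟨k + t, fun r hr => ?_⟩
    rw [← map_smul, ← Submodule.Quotient.mk_smul,
      (Submodule.Quotient.mk_eq_zero _).2 (by simpa using Ideal.mul_mem_right x _ hr), map_zero]
  refine ⟨(φ.comp (Submodule.mkQ _)).codRestrict _ hmem, fun x hx => ?_⟩
  exact Subtype.ext (LinearMap.congr_fun hφ ⟨x, hx⟩)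

variable {M : Type u} [AddCommGroup M] [Module R M]

/-- An element killed by a power of an ideal, as a linear map. -/
lemma exists_hom_of_mem_powTorsion {a : Ideal R} {x : M} {t : ℕ} (h : ∀ r ∈ a ^ t, r • x = 0) :
    ∃ φ : (R ⧸ a ^ t) →ₗ[R] M, φ (Ideal.Quotient.mk _ 1) = x := by
  refine ⟨Submodule.liftQ _ (LinearMap.toSpanSingleton R M x) fun r hr => h r hr, ?_⟩
  exact one_smul R x

lemma IsPowTorsion.mem_powTorsion {a : Ideal R} {N : Type u} [AddCommGroup N] [Module R N]
    (h : IsPowTorsion a N) (φ : N →ₗ[R] M) (x : N) : φ x ∈ powTorsion a M := by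
  obtain ⟨s, hs⟩ := h
  exact ⟨s, fun r hr => by rw [← map_smul, hs r hr, map_zero]⟩

lemma quotient_hom_ext {I : Ideal R} {φ ψ : (R ⧸ I) →ₗ[R] M}
    (h : φ (Ideal.Quotient.mk _ 1) = ψ (Ideal.Quotient.mk _ 1)) : φ = ψ := by
  refine LinearMap.ext fun x => ?_
  obtain ⟨r, rfl⟩ := Ideal.Quotient.mk_surjective x
  have h1 : Ideal.Quotient.mk I r = r • Ideal.Quotient.mk I 1 := by
    rw [Algebra.smul_def, map_one, mul_one]; rfl
  rw [h1, map_smul, map_smul, h]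

lemma powTorsion_eq_bot_of_lcVanish {a : Ideal R} (h : LCVanish a 0 M) : powTorsion a M = ⊥ := by
  refine (Submodule.eq_bot_iff _).2 ?_
  rintro x ⟨t, ht⟩
  obtain ⟨φ, rfl⟩ := exists_hom_of_mem_powTorsion ht
  obtain ⟨s, hs, h0⟩ := h t ((ExtMod.zeroEquiv _ _).symm φ)
  have h1 := congrArg (ExtMod.zeroEquiv _ _) h0
  rw [ExtMod.zeroEquiv_pre, LinearEquiv.apply_symm_apply, map_zero] at h1
  exact LinearMap.congr_fun h1 (Ideal.Quotient.mk _ 1)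

lemma hom_eq_zero_of_powTorsion_eq_bot {a : Ideal R} {N : Type u} [AddCommGroup N] [Module R N]
    (hN : IsPowTorsion a N) (h : powTorsion a M = ⊥) : Subsingleton (ExtMod R N M 0) := by
  refine (ExtMod.zeroEquiv N M).toEquiv.subsingleton_congr.2 (subsingleton_of_forall_eq 0 fun φ => ?_)
  ext x
  have := hN.mem_powTorsion φ x
  rwa [h, Submodule.mem_bot] at this

lemma exists_torsionFree_injective_embedding [IsNoetherianRing R] {a : Ideal R}
    (h : powTorsion a M = ⊥) : ∃ (E : ModuleCat.{u} R) (f : M →ₗ[R] E), Module.Injective R E ∧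
      Function.Injective f ∧ powTorsion a E = ⊥ := by
  obtain ⟨E, f, hE, hf⟩ := exists_injective_embedding R M
  obtain ⟨r, hr⟩ := (hE.powTorsion a).extend (powTorsion a E).subtype Subtype.val_injective
    LinearMap.id
  have hr' (x : powTorsion a E) : r x = x := LinearMap.congr_fun hr x
  let p : E →ₗ[R] LinearMap.ker r :=
    (LinearMap.id - (powTorsion a E).subtype.comp r).codRestrict _ fun x => by simp [hr']
  have hp (x : E) : (p x : E) = x - r x := rfl
  refine ⟨ModuleCat.of R (LinearMap.ker r), p.comp f, ?_, ?_, ?_⟩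
  · refine Module.Injective.of_retract (LinearMap.ker r).subtype p (fun x => ?_) hE
    refine Subtype.ext ((hp _).trans ?_)
    have h0 : r x.1 = 0 := x.2
    exact (congrArg (fun y : powTorsion a E => x.1 - y.1) h0).trans (sub_zero _)
  · rw [injective_iff_map_eq_zero]
    intro m hm
    have h1 : f m = r (f m) := sub_eq_zero.1 ((hp (f m)).symm.trans (congrArg Subtype.val hm))
    obtain ⟨t, ht⟩ := (r (f m)).2
    have : m ∈ powTorsion a M := ⟨t, fun c hc => hf (by rw [map_smul, h1, ht c hc, map_zero])⟩
    rwa [h, Submodule.mem_bot] at this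
  · refine (Submodule.eq_bot_iff _).2 ?_
    rintro ⟨x, hx⟩ ⟨t, ht⟩
    have hx' : x ∈ powTorsion a E := ⟨t, fun c hc => congrArg Subtype.val (ht c hc)⟩
    have h1 := hr' ⟨x, hx'⟩
    exact Subtype.ext ((congrArg Subtype.val h1).symm.trans
      (congrArg Subtype.val (LinearMap.mem_ker.1 hx)))

end PowerTorsion

section LocalCohomologyExt

variable {R : Type u} [CommRing R]

variable {M : Type u} [AddCommGroup M] [Module R M]

lemma exists_pre_δpost_eq_zero {A B D : Type u} [AddCommGroup A] [Module R A] [AddCommGroup B]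
    [Module R B] [AddCommGroup D] [Module R D] {f : A →ₗ[R] B} {g : B →ₗ[R] D} (h : IsSES f g)
    {a : Ideal R} {i : ℕ} (hA : LCVanish a (i + 1) A) {t : ℕ} (x : ExtMod R (R ⧸ a ^ t) D i) :
    ∃ (s : ℕ) (hs : t ≤ s) (y : ExtMod R (R ⧸ a ^ s) B i),
      ExtMod.post _ g i y = ExtMod.pre (powQuot a hs) D i x := by
  obtain ⟨s, hs, h0⟩ := hA t (ExtMod.δpost _ h i x)
  rw [← ExtMod.δpost_pre] at h0
  obtain ⟨y, hy⟩ := (ExtMod.exact_post_δ _ h i _).1 h0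
  exact ⟨s, hs, y, hy⟩

lemma LCVanish.cokernel {A B D : Type u} [AddCommGroup A] [Module R A] [AddCommGroup B]
    [Module R B] [AddCommGroup D] [Module R D] {f : A →ₗ[R] B} {g : B →ₗ[R] D} (h : IsSES f g)
    {a : Ideal R} {i : ℕ} (hB : ∀ t, Subsingleton (ExtMod R (R ⧸ a ^ t) B i))
    (hA : LCVanish a (i + 1) A) : LCVanish a i D := by
  intro t x
  obtain ⟨s, hs, y, hy⟩ := exists_pre_δpost_eq_zero h hA x
  have := hB s
  exact ⟨s, hs, by rw [← hy, Subsingleton.elim y 0, map_zero]⟩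

lemma powTorsion_map_mem {a : Ideal R} {A B : Type u} [AddCommGroup A] [Module R A]
    [AddCommGroup B] [Module R B] (f : A →ₗ[R] B) (x : powTorsion a A) : f x ∈ powTorsion a B := by
  obtain ⟨t, ht⟩ := x.2
  exact ⟨t, fun r hr => by rw [← map_smul, ht r hr, map_zero]⟩

/-- The restriction of a map to torsion submodules. -/
def powTorsionMap (a : Ideal R) {A B : Type u} [AddCommGroup A] [Module R A]
    [AddCommGroup B] [Module R B] (f : A →ₗ[R] B) : powTorsion a A →ₗ[R] powTorsion a B :=
  (f.comp (powTorsion a A).subtype).codRestrict _ (powTorsion_map_mem f)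

lemma IsSES.powTorsion {A B D : Type u} [AddCommGroup A] [Module R A] [AddCommGroup B]
    [Module R B] [AddCommGroup D] [Module R D] {f : A →ₗ[R] B} {g : B →ₗ[R] D} (h : IsSES f g)
    {a : Ideal R} (hA : LCVanish a 1 A) : IsSES (powTorsionMap a f) (powTorsionMap a g) where
  inj x y hxy := Subtype.ext (h.inj (congrArg Subtype.val hxy))
  exact y := by
    refine ⟨fun hy => ?_, ?_⟩
    · obtain ⟨x, hx⟩ := (h.exact y.1).1 (congrArg Subtype.val hy)
      obtain ⟨t, ht⟩ := y.2
      exact ⟨⟨x, t, fun r hr => h.inj (by rw [map_smul, hx, ht r hr, map_zero])⟩, Subtype.ext hx⟩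
    · rintro ⟨x, rfl⟩
      exact Subtype.ext (h.exact.apply_apply_eq_zero x.1)
  surj := by
    rintro ⟨z, t, ht⟩
    obtain ⟨φ, rfl⟩ := exists_hom_of_mem_powTorsion ht
    obtain ⟨s, hs, y, hy⟩ := exists_pre_δpost_eq_zero h hA ((ExtMod.zeroEquiv _ _).symm φ)
    have h1 := congrArg (ExtMod.zeroEquiv _ _) hy
    rw [ExtMod.zeroEquiv_post, ExtMod.zeroEquiv_pre, LinearEquiv.apply_symm_apply] at h1
    exact ⟨⟨_, (isPowTorsion_quotient_pow a s).mem_powTorsion _ _⟩,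
      Subtype.ext (LinearMap.congr_fun h1 (Ideal.Quotient.mk _ 1))⟩

/-- If the higher local cohomology of `M` vanishes, then `Ext` from a torsion module into `M`
may be computed with the torsion submodule. -/
theorem bijective_post_powTorsion_subtype [IsNoetherianRing R] {a : Ideal R} {N : Type u}
    [AddCommGroup N] [Module R N] (hN : IsPowTorsion a N) (i : ℕ) (M : Type u) [AddCommGroup M]
    [Module R M] (hM : ∀ j, 1 ≤ j → LCVanish a j M) :
    Function.Bijective (ExtMod.post N (powTorsion a M).subtype i) := by
  induction i generalizing M with
  | zero =>
    constructor
    · intro x y hxy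
      apply (ExtMod.zeroEquiv _ _).injective
      have := congrArg (ExtMod.zeroEquiv _ _) hxy
      rw [ExtMod.zeroEquiv_post, ExtMod.zeroEquiv_post] at this
      exact LinearMap.ext fun z => Subtype.ext (LinearMap.congr_fun this z)
    · intro y
      refine ⟨(ExtMod.zeroEquiv _ _).symm
        ((ExtMod.zeroEquiv _ _ y).codRestrict _ (hN.mem_powTorsion _)), ?_⟩
      apply (ExtMod.zeroEquiv _ _).injective
      rw [ExtMod.zeroEquiv_post, LinearEquiv.apply_symm_apply]
      rfl
  | succ i ih =>
    obtain ⟨E, f, hE, hf⟩ := exists_injective_embedding R M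
    have hs := IsSES.range f hf
    have hsΓ := hs.powTorsion (hM 1 le_rfl)
    have hEv (X : Type u) [AddCommGroup X] [Module R X] (j : ℕ) (hj : 1 ≤ j) :
        Subsingleton (ExtMod R X E j) := by
      obtain ⟨j, rfl⟩ := Nat.exists_eq_add_of_le' hj
      exact ExtMod.van_of_injective X hE j
    have hbE := ih E fun j hj t x =>
      ⟨t, le_rfl, by rw [(hEv _ j hj).elim x 0, map_zero]⟩
    have hbQ := ih (E ⧸ LinearMap.range f) fun j hj =>
      LCVanish.cokernel hs (fun t => hEv _ j hj) (hM (j + 1) (by lia))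
    have nat := ExtMod.δpost_post N hsΓ hs (powTorsion a M).subtype (powTorsion a E).subtype
      (powTorsion a _).subtype rfl rfl i
    have natg (x : ExtMod R N (powTorsion a E) i) :
        ExtMod.post N (LinearMap.range f).mkQ i (ExtMod.post N (powTorsion a E).subtype i x) =
        ExtMod.post N (powTorsion a _).subtype i
          (ExtMod.post N (powTorsionMap a (LinearMap.range f).mkQ) i x) := by
      rw [← ExtMod.post_comp, ← ExtMod.post_comp]
      rfl
    have hΓ := surjective_of_exact (ExtMod.exact_δ_post N hsΓ i)
      (ExtMod.van_of_injective N (hE.powTorsion a) i)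
    have h1 := surjective_of_exact (ExtMod.exact_δ_post N hs i) (hEv N (i + 1) (by lia))
    constructor
    · rw [injective_iff_map_eq_zero]
      intro x hx
      obtain ⟨q, rfl⟩ := hΓ x
      rw [← nat] at hx
      obtain ⟨e, he⟩ := (ExtMod.exact_post_δ N hs i _).1 hx
      obtain ⟨e, rfl⟩ := hbE.2 e
      rw [natg] at he
      exact (ExtMod.exact_post_δ N hsΓ i _).2 ⟨e, hbQ.1 he⟩
    · intro y
      obtain ⟨q, rfl⟩ := h1 y
      obtain ⟨q, rfl⟩ := hbQ.2 q
      exact ⟨_, (nat q).symm⟩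

lemma IsLC.equiv_powTorsion {a : Ideal R} {T : Type u} [AddCommGroup T] [Module R T]
    (h : IsLC a 0 M T) : Nonempty (T ≃ₗ[R] powTorsion a M) := by
  obtain ⟨ι, h1, h2, h3⟩ := h
  let ev (t : ℕ) : ExtMod R (R ⧸ a ^ t) M 0 →ₗ[R] M :=
    (LinearMap.applyₗ (Ideal.Quotient.mk (a ^ t) 1)).comp (ExtMod.zeroEquiv _ _).toLinearMap
  have ev_pre {t s : ℕ} (hts : t ≤ s) (x) : ev s (ExtMod.pre (powQuot a hts) M 0 x) = ev t x := by
    simp only [ev, LinearMap.comp_apply, LinearEquiv.coe_coe, ExtMod.zeroEquiv_pre]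
    rfl
  have ev_zero (t : ℕ) (x) (hx : ev t x = 0) : x = 0 := by
    apply (ExtMod.zeroEquiv _ _).injective
    exact quotient_hom_ext (by simpa [ev] using hx)
  let S : Submodule R (T × powTorsion a M) :=
    { carrier := {p | ∃ t x, ι t x = p.1 ∧ ev t x = p.2}
      add_mem' := by
        rintro ⟨_, m⟩ ⟨_, m'⟩ ⟨t, x, rfl, hx⟩ ⟨s, y, rfl, hy⟩
        refine ⟨max t s, ExtMod.pre (powQuot a (le_max_left t s)) M 0 x +
          ExtMod.pre (powQuot a (le_max_right t s)) M 0 y, ?_, ?_⟩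
        · rw [map_add, h1, h1]; rfl
        · rw [map_add, ev_pre, ev_pre, hx, hy]; rfl
      zero_mem' := ⟨0, 0, by simp⟩
      smul_mem' := by
        rintro c ⟨_, m⟩ ⟨t, x, rfl, hx⟩
        exact ⟨t, c • x, by rw [map_smul]; rfl, by rw [map_smul, hx]; rfl⟩ }
  refine ⟨LinearEquiv.ofRel S ?_ ?_ ?_ ?_⟩
  · intro z
    obtain ⟨t, x, rfl⟩ := h2 z
    exact ⟨⟨_, (isPowTorsion_quotient_pow a t).mem_powTorsion _ _⟩, t, x, rfl, rfl⟩
  · rintro ⟨m, t, ht⟩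
    obtain ⟨φ, rfl⟩ := exists_hom_of_mem_powTorsion ht
    exact ⟨_, t, (ExtMod.zeroEquiv _ _).symm φ, rfl, by simp [ev]⟩
  · rintro m ⟨t, x, hx, hm⟩
    obtain ⟨s, hs, h0⟩ := h3 t x hx
    refine Subtype.ext ?_
    rw [← hm, ← ev_pre hs, h0, map_zero]
    rfl
  · rintro z ⟨t, x, rfl, hm⟩
    rw [ev_zero t x hm, map_zero]

lemma IsLC.cokernel {A B D T : Type u} [AddCommGroup A] [Module R A] [AddCommGroup B]
    [Module R B] [AddCommGroup D] [Module R D] [AddCommGroup T] [Module R T] {f : A →ₗ[R] B}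
    {g : B →ₗ[R] D} (h : IsSES f g) {a : Ideal R} {i : ℕ}
    (hB : ∀ t, Subsingleton (ExtMod R (R ⧸ a ^ t) B i))
    (hB' : ∀ t, Subsingleton (ExtMod R (R ⧸ a ^ t) B (i + 1)))
    (hA : IsLC a (i + 1) A T) : IsLC a i D T := by
  obtain ⟨ι, h1, h2, h3⟩ := hA
  refine ⟨fun t => (ι t).comp (ExtMod.δpost _ h i), fun t s hs x => ?_, fun z => ?_,
    fun t x hx => ?_⟩
  · rw [LinearMap.comp_apply, ExtMod.δpost_pre, h1]
    rfl
  · obtain ⟨t, x, rfl⟩ := h2 z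
    obtain ⟨x, rfl⟩ := surjective_of_exact (ExtMod.exact_δ_post _ h i) (hB' t) x
    exact ⟨t, x, rfl⟩
  · obtain ⟨s, hs, h0⟩ := h3 t _ hx
    rw [← ExtMod.δpost_pre] at h0
    refine ⟨s, hs, injective_of_exact (ExtMod.exact_post_δ _ h i) (hB s) ?_⟩
    rw [h0, map_zero]

lemma ext_torsionFree_injective_van {E : Type u} [AddCommGroup E] [Module R E]
    (hE : Module.Injective R E) {a : Ideal R} (h : powTorsion a E = ⊥) {N : Type u}
    [AddCommGroup N] [Module R N] (hN : IsPowTorsion a N) (i : ℕ) :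
    Subsingleton (ExtMod R N E i) := by
  cases i with
  | zero => exact hom_eq_zero_of_powTorsion_eq_bot hN h
  | succ i => exact ExtMod.van_of_injective N hE i

/-- If the local cohomology of `M` is concentrated in degree `u`, then its `Ext` from a torsion
module is the `Ext` of `M` up to a shift by `u`. -/
theorem IsLC.ext_equiv [IsNoetherianRing R] {a : Ideal R} {N : Type u} [AddCommGroup N]
    [Module R N] (hN : IsPowTorsion a N) {T : Type u} [AddCommGroup T] [Module R T] (u : ℕ)
    (M : Type u) [AddCommGroup M] [Module R M] (hM : ∀ j, j ≠ u → LCVanish a j M)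
    (hT : IsLC a u M T) (i : ℕ) : Nonempty (ExtMod R N T i ≃ₗ[R] ExtMod R N M (i + u)) := by
  induction u generalizing M with
  | zero =>
    obtain ⟨e⟩ := hT.equiv_powTorsion
    exact ⟨(ExtMod.postEquiv N e i).trans (LinearEquiv.ofBijective _
      (bijective_post_powTorsion_subtype hN i M fun j hj => hM j (by lia)))⟩
  | succ u ih =>
    obtain ⟨E, f, hE, hf, hE0⟩ := exists_torsionFree_injective_embedding
      (powTorsion_eq_bot_of_lcVanish (hM 0 (by lia)))
    have hs := IsSES.range f hf
    have hv (t i : ℕ) := ext_torsionFree_injective_van hE hE0 (isPowTorsion_quotient_pow a t) i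
    obtain ⟨e⟩ := ih (E ⧸ LinearMap.range f)
      (fun j hj => LCVanish.cokernel hs (fun t => hv t j) (hM (j + 1) (by lia)))
      (IsLC.cokernel hs (fun t => hv t u) (fun t => hv t (u + 1)) hT)
    exact ⟨e.trans (ExtMod.shiftPost N hs (i + u) (ext_torsionFree_injective_van hE hE0 hN _)
      (ext_torsionFree_injective_van hE hE0 hN _))⟩

theorem ext_van_of_lcVanish [IsNoetherianRing R] {a : Ideal R} {N : Type u} [AddCommGroup N]
    [Module R N] (hN : IsPowTorsion a N) (u : ℕ) (M : Type u) [AddCommGroup M] [Module R M]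
    (hM : ∀ j, j < u → LCVanish a j M) (i : ℕ) (hi : i < u) : Subsingleton (ExtMod R N M i) := by
  induction u generalizing M i with
  | zero => lia
  | succ u ih =>
    have hΓ := powTorsion_eq_bot_of_lcVanish (hM 0 (by lia))
    obtain ⟨E, f, hE, hf, hE0⟩ := exists_torsionFree_injective_embedding hΓ
    have hs := IsSES.range f hf
    have hv (t i : ℕ) := ext_torsionFree_injective_van hE hE0 (isPowTorsion_quotient_pow a t) i
    cases i with
    | zero => exact hom_eq_zero_of_powTorsion_eq_bot hN hΓ
    | succ i =>
      refine ExtMod.van_post₁ N hs ?_ (ext_torsionFree_injective_van hE hE0 hN _)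
      exact ih (E ⧸ LinearMap.range f)
        (fun j hj => LCVanish.cokernel hs (fun t => hv t j) (hM (j + 1) (by lia))) i (by lia)

end LocalCohomologyExt

section Bass

variable {R : Type u} [CommRing R]

lemma ext_van_of_forall_prime [IsNoetherianRing R] (M : Type u) [AddCommGroup M] [Module R M]
    (i : ℕ) (N : Type u) [AddCommGroup N] [Module R N] [hN : Module.Finite R N]
    (h : ∀ p : PrimeSpectrum R, Module.annihilator R N ≤ p.asIdeal →
      Subsingleton (ExtMod R (R ⧸ p.asIdeal) M i)) : Subsingleton (ExtMod R N M i) := by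
  induction hN using IsNoetherianRing.induction_on_isQuotientEquivQuotientPrime with
  | subsingleton N => exact ExtMod.van_of_subsingleton_left M i
  | quotient N p e =>
    refine ExtMod.van_pre e.symm M (h p ?_)
    rw [e.annihilator_eq, Ideal.annihilator_quotient]
  | exact N₁ N₂ N₃ f g hf hg hfg h₁ h₃ =>
    have hs : IsSES f g := ⟨hf, hfg, hg⟩
    exact ExtMod.van_pre₂ hs M
      (h₃ fun p hp => h p ((LinearMap.annihilator_le_of_surjective g hg).trans hp))
      (h₁ fun p hp => h p ((LinearMap.annihilator_le_of_injective f hf).trans hp))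

lemma subsingleton_of_smul_surjective [IsLocalRing R] {x : R}
    (hx : x ∈ IsLocalRing.maximalIdeal R) (E : Type u) [AddCommGroup E] [Module R E]
    [Module.Finite R E] (h : ∀ e : E, ∃ e', x • e' = e) : Subsingleton E := by
  have : (⊤ : Submodule R E) = ⊥ := by
    refine Submodule.eq_bot_of_le_smul_of_le_jacobson_bot (Ideal.span {x}) ⊤ Module.Finite.fg_top
      (fun e _ => ?_) ?_
    · obtain ⟨e', rfl⟩ := h e
      exact Submodule.smul_mem_smul (Ideal.mem_span_singleton_self x) trivial
    · rw [IsLocalRing.jacobson_eq_maximalIdeal ⊥ bot_ne_top, Ideal.span_singleton_le_iff_mem]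
      exact hx
  exact (Submodule.subsingleton_iff R).1 (subsingleton_of_bot_eq_top this.symm)

/-- Bass' lemma: `Ext` from a prime is controlled by `Ext` from strictly larger primes. -/
lemma ext_quotient_prime_van [IsNoetherianRing R] [IsLocalRing R] (M : Type u) [AddCommGroup M]
    [Module R M] [Module.Finite R M] (p : PrimeSpectrum R)
    (hp : p.asIdeal ≠ IsLocalRing.maximalIdeal R) (i : ℕ)
    (h : ∀ q : PrimeSpectrum R, p.asIdeal < q.asIdeal →
      Subsingleton (ExtMod R (R ⧸ q.asIdeal) M (i + 1))) :
    Subsingleton (ExtMod R (R ⧸ p.asIdeal) M i) := by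
  obtain ⟨x, hx, hxp⟩ := SetLike.exists_of_lt
    (lt_of_le_of_ne (IsLocalRing.le_maximalIdeal p.2.ne_top) hp)
  have hs : IsSES (LinearMap.lsmul R (R ⧸ p.asIdeal) x) _ := IsSES.range _ fun a b hab => by
    obtain ⟨a, rfl⟩ := Ideal.Quotient.mk_surjective a
    obtain ⟨b, rfl⟩ := Ideal.Quotient.mk_surjective b
    rw [LinearMap.lsmul_apply, LinearMap.lsmul_apply, Algebra.smul_def, Algebra.smul_def] at hab
    refine mul_left_cancel₀ ?_ hab
    exact fun h0 => hxp (Ideal.Quotient.eq_zero_iff_mem.1 h0)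
  have hD := ext_van_of_forall_prime M (i + 1)
      ((R ⧸ p.asIdeal) ⧸ LinearMap.range (LinearMap.lsmul R (R ⧸ p.asIdeal) x)) fun q hq => by
    refine h q (lt_of_le_of_ne (fun r hr => hq ?_) ?_)
    · refine Module.mem_annihilator.2 fun m => ?_
      obtain ⟨m, rfl⟩ := Submodule.mkQ_surjective _ m
      obtain ⟨m, rfl⟩ := Ideal.Quotient.mk_surjective m
      rw [← map_smul, Algebra.smul_def, Ideal.Quotient.algebraMap_eq,
        Ideal.Quotient.eq_zero_iff_mem.2 hr, zero_mul, map_zero]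
    · rintro h0
      refine hxp (h0 ▸ hq (Module.mem_annihilator.2 fun m => ?_))
      obtain ⟨m, rfl⟩ := Submodule.mkQ_surjective _ m
      rw [← map_smul]
      exact (Submodule.Quotient.mk_eq_zero _).2 ⟨m, rfl⟩
  refine subsingleton_of_smul_surjective hx _ fun e => ?_
  obtain ⟨e', he⟩ := surjective_of_exact (ExtMod.exact_pre_δ hs M i) hD e
  refine ⟨e', ?_⟩
  rw [← he, ← ExtMod.pre_id i e', ← ExtMod.pre_smul]
  simp only [ExtMod.pre_id]
  rfl

lemma ext_quotient_prime_van_of_lt_height [IsNoetherianRing R] [IsLocalRing R] (M : Type u)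
    [AddCommGroup M] [Module R M] [Module.Finite R M]
    (h : ∀ i : ℕ, (i : ℕ∞) < (IsLocalRing.maximalIdeal R).height →
      Subsingleton (ExtMod R (R ⧸ IsLocalRing.maximalIdeal R) M i))
    (p : PrimeSpectrum R) (i : ℕ) (hi : (i : ℕ∞) < p.asIdeal.height) :
    Subsingleton (ExtMod R (R ⧸ p.asIdeal) M i) := by
  have : WellFoundedGT (PrimeSpectrum R) :=
    StrictMono.wellFoundedGT (f := PrimeSpectrum.asIdeal) fun _ _ h => h
  induction p using WellFoundedGT.induction generalizing i with
  | ind p ih =>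
    by_cases hp : p.asIdeal = IsLocalRing.maximalIdeal R
    · rw [hp] at hi ⊢
      exact h i hi
    · refine ext_quotient_prime_van M p hp i fun q hq => ih q hq _ ?_
      have h1 := p.2
      have h2 := Ideal.height_strict_mono_of_isPrime hq
      push_cast
      exact lt_of_le_of_lt (Order.add_one_le_of_lt hi) h2

lemma ext_quotient_prime_van_of_ge [IsNoetherianRing R] [IsLocalRing R] (M : Type u)
    [AddCommGroup M] [Module R M] [Module.Finite R M] (t : ℕ)
    (h : ∀ i : ℕ, t ≤ i → Subsingleton (ExtMod R (R ⧸ IsLocalRing.maximalIdeal R) M i))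
    (p : PrimeSpectrum R) (i : ℕ) (hi : t ≤ i) :
    Subsingleton (ExtMod R (R ⧸ p.asIdeal) M i) := by
  have : WellFoundedGT (PrimeSpectrum R) :=
    StrictMono.wellFoundedGT (f := PrimeSpectrum.asIdeal) fun _ _ h => h
  induction p using WellFoundedGT.induction generalizing i with
  | ind p ih =>
    by_cases hp : p.asIdeal = IsLocalRing.maximalIdeal R
    · rw [hp]
      exact h i hi
    · exact ext_quotient_prime_van M p hp i fun q hq => ih q hq _ (by lia)

lemma hasCoresDimLE_injective_of_ext_van (t : ℕ) (M : Type u) [AddCommGroup M] [Module R M]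
    (h : ∀ I : Ideal R, Subsingleton (ExtMod R (R ⧸ I) M (t + 1))) :
    HasCoresDimLE R (fun N => Module.Injective R N) t (ModuleCat.of R M) := by
  induction t generalizing M with
  | zero => exact .inr (injective_of_ext_quotient_van M h)
  | succ t ih =>
    obtain ⟨E, f, hE, hf⟩ := exists_injective_embedding R M
    exact .inr ⟨E, f, hE, hf, ih _ fun I => ExtMod.van_post₃ _ (IsSES.range f hf)
      (ExtMod.van_of_injective _ hE t) (h I)⟩

lemma coresDim_ne_top_iff (P : ModuleCat.{u} R → Prop) (M : ModuleCat.{u} R) :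
    coresDim R P M ≠ ⊤ ↔ ∃ n, HasCoresDimLE R P n M := by
  rw [coresDim, ne_eq, sInf_eq_top]
  push Not
  constructor
  · rintro ⟨_, ⟨n, -, hn⟩, -⟩
    exact ⟨n, hn⟩
  · rintro ⟨n, hn⟩
    exact ⟨n, ⟨n, rfl, hn⟩, ENat.natCast_ne_top n⟩

lemma injDim_ne_top_of_ext_van [IsNoetherianRing R] [IsLocalRing R] (M : ModuleCat.{u} R)
    [Module.Finite R M] (t : ℕ)
    (h : ∀ i : ℕ, t ≤ i → Subsingleton (ExtMod R (R ⧸ IsLocalRing.maximalIdeal R) M i)) :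
    injDim R M ≠ ⊤ :=
  (coresDim_ne_top_iff _ M).2 ⟨t, hasCoresDimLE_injective_of_ext_van t M fun _ =>
    ext_van_of_forall_prime M _ _ fun p _ => ext_quotient_prime_van_of_ge M t h p _ (by lia)⟩

end Bass

section Height

variable {R : Type u} [CommRing R]

lemma heightWRT_self (a : Ideal R) :
    heightWRT R a R = ⨅ (p : PrimeSpectrum R) (_ : a ≤ p.asIdeal), (p.asIdeal.height : WithBot ℕ∞) := by
  have hs (p : PrimeSpectrum R) :
      p ∈ Module.support R (R ⧸ (a • (⊤ : Submodule R R))) ↔ a ≤ p.asIdeal := by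
    rw [smul_eq_mul, Ideal.mul_top, Module.mem_support_iff_of_finite, Ideal.annihilator_quotient]
  refine iInf_congr fun p => iInf_congr_Prop (hs p) fun _ => ?_
  let e := (IsLocalizedModule.linearEquiv p.asIdeal.primeCompl
    (LocalizedModule.mkLinearMap p.asIdeal.primeCompl R)
    (Algebra.linearMap R (Localization.AtPrime p.asIdeal))).extendScalarsOfIsLocalization
      p.asIdeal.primeCompl (Localization.AtPrime p.asIdeal)
  rw [moduleKrullDim, e.annihilator_eq, Module.annihilator_eq_bot.2 inferInstance,
    ringKrullDim_eq_of_ringEquiv (RingEquiv.quotientBot _),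
    IsLocalization.AtPrime.ringKrullDim_eq_height p.asIdeal]

lemma length_le_height_of_isRegular [IsNoetherianRing R] (rs : List R)
    (h : RingTheory.Sequence.IsRegular R rs) (p : Ideal R) [p.IsPrime] (hp : ∀ r ∈ rs, r ∈ p) :
    (rs.length : ℕ∞) ≤ p.height := by
  have h' := h.1.isRegular_of_isLocalization_of_mem (Localization.AtPrime p) p hp
  have h2 := ringKrullDim_add_length_eq_ringKrullDim_of_isRegular _ h'
  rw [List.length_map, IsLocalization.AtPrime.ringKrullDim_eq_height p (Localization.AtPrime p)] at h2
  have key (D : WithBot ℕ∞) (hD : D + (rs.length : WithBot ℕ∞) = p.height) :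
      (rs.length : ℕ∞) ≤ p.height := by
    cases D with
    | bot => simp at hD
    | coe D =>
      rw [← WithBot.coe_injective
        (by exact_mod_cast hD : ((D + rs.length : ℕ∞) : WithBot ℕ∞) = p.height)]
      exact le_add_self
  exact key _ h2

lemma exists_isRegular_of_ext_van [IsNoetherianRing R] (a : Ideal R) (ha : a ≠ ⊤) (u : ℕ)
    (h : ∀ i < u, Subsingleton (ExtMod R (R ⧸ a) R i)) :
    ∃ rs : List R, rs.length = u ∧ (∀ r ∈ rs, r ∈ a) ∧ RingTheory.Sequence.IsRegular R rs := by
  refine ModuleCat.exists_isRegular_of_exists_subsingleton_ext a u (ModuleCat.of R R) ?_ 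
    (ModuleCat.of R (R ⧸ a)) ?_ h
  · rw [smul_eq_mul, Ideal.mul_top]
    exact lt_top_iff_ne_top.2 ha
  · rw [Module.support_eq_zeroLocus, Ideal.annihilator_quotient]

lemma IsCohenMacaulayLocalRing.lcVanish [IsNoetherianRing R] [IsLocalRing R]
    (h : IsCohenMacaulayLocalRing R) (i : ℕ)
    (hi : (i : ℕ∞) ≠ (IsLocalRing.maximalIdeal R).height) :
    LCVanish (IsLocalRing.maximalIdeal R) i R := by
  refine (isLC_localCohomology _ i (ModuleCat.of R R)).subsingleton_iff.1 (h i ?_)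
  rw [← IsLocalRing.maximalIdeal_height_eq_ringKrullDim]
  exact fun h => hi (WithBot.coe_injective h)

lemma isPowTorsion_quotient (a : Ideal R) : IsPowTorsion a (R ⧸ a) := by
  have := isPowTorsion_quotient_pow a 1
  rwa [pow_one] at this

lemma IsCohenMacaulayLocalRing.ext_residue_van [IsNoetherianRing R] [IsLocalRing R]
    (h : IsCohenMacaulayLocalRing R) (i : ℕ)
    (hi : (i : ℕ∞) < (IsLocalRing.maximalIdeal R).height) :
    Subsingleton (ExtMod R (R ⧸ IsLocalRing.maximalIdeal R) R i) := by
  refine ext_van_of_lcVanish (isPowTorsion_quotient _) (i + 1) R (fun j hj => h.lcVanish j ?_) i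
    (by lia)
  exact (lt_of_le_of_lt (by exact_mod_cast Nat.le_of_lt_succ hj) hi).ne

/-- Over a Cohen-Macaulay local ring the height of `a` is the unique degree of nonvanishing local
cohomology, if such a degree exists. -/
theorem lcDegree_eq_height [IsNoetherianRing R] [IsLocalRing R]
    (h : IsCohenMacaulayLocalRing R) (a : Ideal R) (u n : ℕ) (hu : ¬ LCVanish a u R)
    (hv : ∀ j, j ≠ u → LCVanish a j R) (hn : heightWRT R a R = n) :
    u = n ∧ a ≠ ⊤ := by
  rw [heightWRT_self] at hn
  obtain ⟨p, hp, hpn⟩ : ∃ p : PrimeSpectrum R, a ≤ p.asIdeal ∧ p.asIdeal.height ≤ n := by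
    by_contra! hc
    have : ((n + 1 : ℕ) : WithBot ℕ∞) ≤ n := hn ▸ le_iInf₂ fun p hp => by
      exact_mod_cast Order.add_one_le_of_lt (hc p hp)
    exact absurd (by exact_mod_cast this) (Nat.not_succ_le_self n)
  have ha : a ≠ ⊤ := fun h0 => p.2.ne_top (top_le_iff.1 (h0 ▸ hp))
  refine ⟨le_antisymm ?_ ?_, ha⟩
  · obtain ⟨rs, hl, hrs, hreg⟩ := exists_isRegular_of_ext_van a ha u fun i hi =>
      ext_van_of_lcVanish (isPowTorsion_quotient _) u R (fun j hj => hv j hj.ne) i hi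
    have := (length_le_height_of_isRegular rs hreg p.asIdeal fun r hr => hp (hrs r hr)).trans hpn
    rw [hl] at this
    exact_mod_cast this
  · by_contra hlt
    refine hu fun t x => ⟨t, le_rfl, ?_⟩
    have : Subsingleton (ExtMod R (R ⧸ a ^ t) R u) := by
      refine ext_van_of_forall_prime R u (R ⧸ a ^ t) fun q hq =>
        ext_quotient_prime_van_of_lt_height R h.ext_residue_van q u ?_
      rw [Ideal.annihilator_quotient] at hq
      have h1 := hn.ge.trans (iInf₂_le q (q.2.le_of_pow_le hq))
      exact lt_of_lt_of_le (by exact_mod_cast not_le.1 hlt) (WithBot.coe_le_coe.1 h1)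
    exact Subsingleton.elim _ _

end Height

section HomEvaluation

variable {R : Type u} [CommRing R]
  {A B D : Type u} [AddCommGroup A] [Module R A] [AddCommGroup B] [Module R B]
  [AddCommGroup D] [Module R D]

lemma IsSES.lcomp {f : A →ₗ[R] B} {g : B →ₗ[R] D} (h : IsSES f g) (Y : Type u) [AddCommGroup Y]
    [Module R Y] (hY : Subsingleton (ExtMod R D Y 1)) :
    IsSES (LinearMap.lcomp R Y g) (LinearMap.lcomp R Y f) :=
  ⟨LinearMap.lcomp_injective_of_surjective g h.surj,
    LinearMap.exact_lcomp_of_exact_of_surjective Y h.exact h.surj,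
    fun φ => ExtMod.extend_of_van h hY φ⟩

lemma exact_compRight (X : Type u) [AddCommGroup X] [Module R X] {f : A →ₗ[R] B} {g : B →ₗ[R] D}
    (hf : Function.Injective f) (h : Function.Exact f g) :
    Function.Exact (f.compRight R (M := X)) (g.compRight R (M := X)) := by
  intro φ
  constructor
  · intro hφ
    have hm (x : X) : φ x ∈ LinearMap.range f := (h _).1 (LinearMap.congr_fun hφ x)
    refine ⟨(LinearEquiv.ofInjective f hf).symm.toLinearMap.comp (φ.codRestrict _ hm), ?_⟩
    ext x
    exact congrArg Subtype.val ((LinearEquiv.ofInjective f hf).apply_symm_apply ⟨φ x, hm x⟩)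
  · rintro ⟨ψ, rfl⟩
    ext x
    exact h.apply_apply_eq_zero _

lemma IsSES.compRight (X : Type u) [AddCommGroup X] [Module R X] {f : A →ₗ[R] B} {g : B →ₗ[R] D}
    (h : IsSES f g) (hX : Subsingleton (ExtMod R X A 1)) :
    IsSES (f.compRight R (M := X)) (g.compRight R (M := X)) :=
  ⟨fun _ _ hφ => LinearMap.ext fun x => h.inj (LinearMap.congr_fun hφ x),
    exact_compRight X h.inj h.exact, fun φ => ExtMod.lift_of_van h hX φ⟩

lemma Module.Injective.hom {F E : Type u} [AddCommGroup F] [Module R F] [Module.Flat R F]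
    [AddCommGroup E] [Module R E] (hE : Module.Injective R E) : Module.Injective R (F →ₗ[R] E) := by
  refine ⟨fun X Y _ _ _ _ f hf g => ?_⟩
  obtain ⟨k, hk⟩ := hE.out (f.rTensor F)
    (Module.Flat.rTensor_preserves_injective_linearMap f hf) (TensorProduct.lift g)
  refine ⟨TensorProduct.curry k, fun x => LinearMap.ext fun y => ?_⟩
  exact hk (x ⊗ₜ y)

/-- The Hom evaluation map `C ⊗ Hom(X, J) → Hom(Hom(C, X), J)`. -/
def homEval (C X J : Type u) [AddCommGroup C] [Module R C] [AddCommGroup X] [Module R X]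
    [AddCommGroup J] [Module R J] : C ⊗[R] (X →ₗ[R] J) →ₗ[R] (C →ₗ[R] X) →ₗ[R] J :=
  TensorProduct.lift ((LinearMap.llcomp R (C →ₗ[R] X) X J).flip ∘ₗ LinearMap.applyₗ)

variable {X J : Type u} [AddCommGroup X] [Module R X] [AddCommGroup J] [Module R J]

@[simp]
lemma homEval_tmul (c : A) (f : X →ₗ[R] J) (g : A →ₗ[R] X) :
    homEval A X J (c ⊗ₜ f) g = f (g c) := rfl

lemma homEval_naturality (f : A →ₗ[R] B) :
    homEval B X J ∘ₗ f.rTensor _ = LinearMap.lcomp R J (LinearMap.lcomp R X f) ∘ₗ homEval A X J :=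
  TensorProduct.ext' fun _ _ => rfl

lemma homEval_bijective_pi (n : ℕ) : Function.Bijective (homEval (R := R) (Fin n → R) X J) := by
  let r (i : Fin n) : X →ₗ[R] (Fin n → R) →ₗ[R] X :=
    LinearMap.smulRightₗ (LinearMap.proj i : (Fin n → R) →ₗ[R] R)
  let inv (φ : ((Fin n → R) →ₗ[R] X) →ₗ[R] J) : (Fin n → R) ⊗[R] (X →ₗ[R] J) :=
    ∑ i, (Pi.single i 1 : Fin n → R) ⊗ₜ[R] (φ.comp (r i))
  have hadd (φ ψ : ((Fin n → R) →ₗ[R] X) →ₗ[R] J) : inv (φ + ψ) = inv φ + inv ψ := by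
    simp only [inv, LinearMap.add_comp, TensorProduct.tmul_add, Finset.sum_add_distrib]
  refine Function.bijective_iff_has_inverse.2 ⟨inv, fun t => ?_, fun φ => LinearMap.ext fun g => ?_⟩
  · induction t with
    | zero => simp [inv]
    | add x y hx hy =>
      rw [map_add, hadd, hx, hy]
    | tmul c f =>
      have h (i : Fin n) : (homEval (Fin n → R) X J (c ⊗ₜ f)).comp (r i) = c i • f :=
        LinearMap.ext fun x => by simp [r]
      simp only [inv, h, ← TensorProduct.smul_tmul, ← TensorProduct.sum_tmul]
      rw [← pi_eq_sum_univ' c]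
  · simp only [inv, map_sum, LinearMap.sum_apply, homEval_tmul, LinearMap.comp_apply]
    rw [← map_sum]
    congr 1
    refine LinearMap.pi_ext' fun i => LinearMap.ext_ring ?_
    simp [r, Pi.single_apply]

lemma homEval_surjective [IsNoetherianRing R] (hJ : Module.Injective R J) [Module.Finite R A] :
    Function.Surjective (homEval (R := R) A X J) := by
  obtain ⟨n, p, hp⟩ := Module.Finite.exists_fin' R A
  intro φ
  obtain ⟨ψ, hψ⟩ := hJ.extend _ (LinearMap.lcomp_injective_of_surjective (N := X) p hp) φ
  obtain ⟨t, rfl⟩ := (homEval_bijective_pi n).2 ψ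
  exact ⟨p.rTensor _ t, (LinearMap.congr_fun (homEval_naturality p) t).trans hψ⟩

lemma homEval_bijective [IsNoetherianRing R] (hJ : Module.Injective R J) [Module.Finite R A] :
    Function.Bijective (homEval (R := R) A X J) := by
  obtain ⟨n, p, hp⟩ := Module.Finite.exists_fin' R A
  have hs := IsSES.ker p hp
  refine ⟨?_, homEval_surjective hJ⟩
  refine LinearMap.injective_of_surjective_of_injective_of_right_exact _ _ _ _ _ _ _
    (homEval_naturality _).symm (homEval_naturality _).symm (rTensor_exact _ hs.exact hp) ?_
    (homEval_surjective hJ) (homEval_bijective_pi n).1 (LinearMap.rTensor_surjective _ hp)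
  intro φ
  have he := LinearMap.exact_lcomp_of_exact_of_surjective X hs.exact hp
  constructor
  · intro hφ
    refine hJ.extend_of_ker_le (LinearMap.lcomp R X (LinearMap.ker p).subtype) φ fun x hx => ?_
    obtain ⟨y, rfl⟩ := (he x).1 hx
    exact LinearMap.congr_fun hφ y
  · rintro ⟨ψ, rfl⟩
    ext y
    simp only [LinearMap.lcomp_apply', LinearMap.comp_apply]
    exact (congrArg ψ (he.apply_apply_eq_zero y)).trans (map_zero ψ)

/-- `Hom(C, E)` is acyclic for `Ext` from `Hom(X, J)` if `C` is acyclic for `Ext` into `X`. -/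
theorem ext_hom_hom_van [IsNoetherianRing R] (C X J E : Type u) [AddCommGroup C] [Module R C]
    [Module.Finite R C] [AddCommGroup X] [Module R X] [AddCommGroup J] [Module R J]
    [AddCommGroup E] [Module R E] (hX : ∀ i, Subsingleton (ExtMod R C X (i + 1)))
    (hJ : Module.Injective R J) (hE : Module.Injective R E) (i : ℕ) :
    Subsingleton (ExtMod R (X →ₗ[R] J) (C →ₗ[R] E) (i + 1)) := by
  induction i generalizing C with
  | zero =>
    obtain ⟨n, p, hp⟩ := Module.Finite.exists_fin' R C
    have hs := IsSES.ker p hp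
    have hs' := hs.lcomp E (ExtMod.van_of_injective _ hE 0)
    refine ExtMod.van_one_of_lift hs' (ExtMod.van_of_injective _ hE.hom 0) fun φ => ?_
    have hinj : Function.Injective ((LinearMap.ker p).subtype.rTensor (X →ₗ[R] J)) := by
      refine Function.Injective.of_comp (f := homEval (Fin n → R) X J) ?_
      rw [← LinearMap.coe_comp, homEval_naturality, LinearMap.coe_comp]
      exact (LinearMap.lcomp_injective_of_surjective _ (hs.lcomp X (hX 0)).surj).comp
        (homEval_bijective hJ).1
    obtain ⟨k, hk⟩ := hE.extend (A := LinearMap.ker p ⊗[R] (X →ₗ[R] J)) _ hinj (TensorProduct.lift φ.flip)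
    refine ⟨(TensorProduct.curry k).flip, LinearMap.ext fun f => LinearMap.ext fun c => ?_⟩
    exact LinearMap.congr_fun hk (c ⊗ₜ f)
  | succ i ih =>
    obtain ⟨n, p, hp⟩ := Module.Finite.exists_fin' R C
    have hs := IsSES.ker p hp
    exact ExtMod.van_post₁ _ (hs.lcomp E (ExtMod.van_of_injective _ hE 0))
      (ih (LinearMap.ker p) fun i => ExtMod.van_pre₁ hs X (ExtMod.van_of_projective X i) (hX _))
      (ExtMod.van_of_injective _ hE.hom _)

end HomEvaluation

section Coresolutions

variable {R : Type u} [CommRing R]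

/-- The cokernel in a short exact sequence. -/
def IsSES.quotEquiv {A B D : Type u} [AddCommGroup A] [Module R A] [AddCommGroup B] [Module R B]
    [AddCommGroup D] [Module R D] {f : A →ₗ[R] B} {g : B →ₗ[R] D} (h : IsSES f g) :
    (B ⧸ LinearMap.range f) ≃ₗ[R] D :=
  (Submodule.quotEquivOfEq _ _ h.exact.linearMap_ker_eq.symm).trans
    (g.quotKerEquivOfSurjective h.surj)

lemma HasCoresDimLE.mono {P Q : ModuleCat.{u} R → Prop} (h : ∀ X, P X → Q X) {n : ℕ}
    {M : ModuleCat.{u} R} (hM : HasCoresDimLE R P n M) : HasCoresDimLE R Q n M := by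
  induction n generalizing M with
  | zero => exact hM.imp id (h M)
  | succ n ih =>
    refine hM.imp id ?_
    rintro ⟨X, f, hX, hf, hq⟩
    exact ⟨X, f, h X hX, hf, ih hq⟩

lemma HasCoresDimLE.of_equiv {P : ModuleCat.{u} R → Prop}
    (h : ∀ X Y : ModuleCat.{u} R, (X ≃ₗ[R] Y) → P X → P Y) {n : ℕ} {M N : ModuleCat.{u} R}
    (e : M ≃ₗ[R] N) (hM : HasCoresDimLE R P n M) : HasCoresDimLE R P n N := by
  cases n with
  | zero => exact hM.imp (fun (_ : Subsingleton M) => e.symm.toEquiv.subsingleton) (h M N e)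
  | succ n =>
    refine hM.imp (fun (_ : Subsingleton M) => e.symm.toEquiv.subsingleton) ?_
    rintro ⟨X, f, hX, hf, hq⟩
    refine ⟨X, f.comp e.symm.toLinearMap, hX, hf.comp e.symm.injective, ?_⟩
    rwa [LinearEquiv.range_comp]

lemma IsCInjective.of_equiv {C M N : ModuleCat.{u} R} (e : M ≃ₗ[R] N) (h : IsCInjective R C M) :
    IsCInjective R C N := by
  obtain ⟨I, hI, ⟨e'⟩⟩ := h
  exact ⟨I, hI, ⟨e.symm.trans e'⟩⟩

lemma hasCoresDimLE_hom (C : ModuleCat.{u} R) (g : ℕ) (X : ModuleCat.{u} R)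
    (hX : HasCoresDimLE R (fun N => Module.Injective R N) g X)
    (hC : ∀ i, Subsingleton (ExtMod R C X (i + 1))) :
    HasCoresDimLE R (IsCInjective R C) g (ModuleCat.of R (C →ₗ[R] X)) := by
  induction g generalizing X with
  | zero =>
    refine hX.imp (fun (_ : Subsingleton X) => ⟨fun φ ψ => LinearMap.ext fun _ => Subsingleton.elim _ _⟩) fun h => ?_
    exact ⟨X, h, ⟨.refl R _⟩⟩
  | succ g ih =>
    refine hX.imp (fun (_ : Subsingleton X) => ⟨fun φ ψ => LinearMap.ext fun _ => Subsingleton.elim _ _⟩) ?_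
    rintro ⟨E, f, hE, hf, hq⟩
    have hs := IsSES.range f hf
    have hs' := hs.compRight C (hC 0)
    refine ⟨ModuleCat.of R (C →ₗ[R] E), f.compRight R, ⟨E, hE, ⟨.refl R _⟩⟩, hs'.inj, ?_⟩
    exact (ih _ hq fun i => ExtMod.van_post₃ _ hs (ExtMod.van_of_injective _ hE _)
      (hC (i + 1))).of_equiv (fun _ _ => IsCInjective.of_equiv) hs'.quotEquiv.symm

end Coresolutions

namespace InjCores

variable {R : Type u} [CommRing R] (M : ModuleCat.{u} R)

/-- A chosen injective module containing `M`. -/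
def hull : ModuleCat.{u} R := (exists_injective_embedding R M).choose

/-- The embedding of `M` in a chosen injective module. -/
def ι : M →ₗ[R] hull M := (exists_injective_embedding R M).choose_spec.choose

lemma injective_hull : Module.Injective R (hull M) :=
  (exists_injective_embedding R M).choose_spec.choose_spec.1

lemma ι_injective : Function.Injective (ι M) :=
  (exists_injective_embedding R M).choose_spec.choose_spec.2

/-- The cosyzygies of `M`. -/
def cosyz : ℕ → ModuleCat.{u} R
  | 0 => M
  | n + 1 => ModuleCat.of R (hull (cosyz n) ⧸ LinearMap.range (ι (cosyz n)))

/-- The projection to the next cosyzygy. -/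
def π (n : ℕ) : hull (cosyz M n) →ₗ[R] cosyz M (n + 1) := Submodule.mkQ _

lemma isSES (n : ℕ) : IsSES (ι (cosyz M n)) (π M n) := IsSES.range _ (ι_injective _)

/-- The differential of the injective coresolution. -/
def diff (n : ℕ) : hull (cosyz M n) →ₗ[R] hull (cosyz M (n + 1)) := (ι _).comp (π M n)

lemma exact_ι_diff (n : ℕ) : Function.Exact (ι (cosyz M n)) (diff M n) := fun x => by
  rw [← (isSES M n).exact x, diff, LinearMap.comp_apply, map_eq_zero_iff _ (ι_injective _)]

lemma exact_diff (n : ℕ) : Function.Exact (diff M n) (diff M (n + 1)) := fun x => by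
  rw [exact_ι_diff M (n + 1) x, diff, LinearMap.coe_comp, (isSES M n).surj.range_comp]

variable {M} {W : ModuleCat.{u} R}

lemma ext_van_cosyz (hW : ∀ i, Subsingleton (ExtMod R W M (i + 1))) (n i : ℕ) :
    Subsingleton (ExtMod R W (cosyz M n) (i + 1)) := by
  induction n generalizing i with
  | zero => exact hW i
  | succ n ih =>
    exact ExtMod.van_post₃ _ (isSES M n) (ExtMod.van_of_injective _ (injective_hull _) _)
      (ih (i + 1))

lemma exact_hom_diff (hW : ∀ i, Subsingleton (ExtMod R W M (i + 1))) (n : ℕ) : Function.Exact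
    ((diff M n).compRight R (M := W)) ((diff M (n + 1)).compRight R (M := W)) := fun φ => by
  rw [exact_compRight W (ι_injective _) (exact_ι_diff M (n + 1)) φ]
  have : (diff M n).compRight R (M := W) =
      (ι (cosyz M (n + 1))).compRight R ∘ₗ (π M n).compRight R := rfl
  rw [this, LinearMap.coe_comp,
    ((isSES M n).compRight W (ext_van_cosyz hW n 0)).surj.range_comp]

end InjCores

section CInjective

variable {R : Type u} [CommRing R]

open InjCores

/-- The terms of the complex `0 → M → E⁰ → E¹ → ⋯`. -/
def augTerm (M : ModuleCat.{u} R) : ℤ → ModuleCat.{u} R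
  | .ofNat 0 => hull (cosyz M 0)
  | .ofNat 1 => M
  | .ofNat (_ + 2) => ModuleCat.of R PUnit
  | .negSucc n => hull (cosyz M (n + 1))

/-- The differentials of the complex `0 → M → E⁰ → E¹ → ⋯`. -/
def augDiff (M : ModuleCat.{u} R) : (i : ℤ) → (augTerm M (i + 1) →ₗ[R] augTerm M i)
  | .ofNat 0 => ι (cosyz M 0)
  | .ofNat (_ + 1) => 0
  | .negSucc 0 => diff M 0
  | .negSucc (n + 1) => diff M (n + 1)

lemma isGCInjective_of_ext_van {C M : ModuleCat.{u} R} (hM : IsCInjective R C M)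
    (h : ∀ W, IsCInjective R C W → ∀ i, Subsingleton (ExtMod R W M (i + 1))) :
    IsGCInjective R C M := by
  refine ⟨⟨augTerm M, augDiff M, ?_, ?_, ?_, ?_⟩, ?_⟩
  · rintro ((_ | n) | (_ | n))
    · intro x
      refine ⟨fun hx => ⟨0, ((map_eq_zero_iff _ (ι_injective M)).1 hx).symm⟩, ?_⟩
      rintro ⟨y, rfl⟩
      exact map_zero _
    · exact fun _ => ⟨fun _ => ⟨0, rfl⟩, fun _ => rfl⟩
    · exact exact_ι_diff M 0
    · cases n <;> exact exact_diff M _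
  · rintro ((_ | _ | n) | n) hi
    · exact absurd hi (lt_irrefl _)
    · exact hM
    · exact ⟨ModuleCat.of R PUnit, ⟨fun _ _ _ _ _ _ _ _ _ => ⟨0, fun _ => rfl⟩⟩,
        ⟨⟨0, 0, fun _ => rfl, fun _ => LinearMap.ext fun _ => rfl⟩⟩⟩
    · exact absurd hi (by omega)
  · rintro ((_ | n) | n) hi
    · exact injective_hull _
    · exact absurd hi (by simp)
    · exact injective_hull _
  · rintro W hW ((_ | n) | (_ | n))
    · intro φ
      refine ⟨fun hx => ⟨0, ?_⟩, ?_⟩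
      · exact LinearMap.ext fun w => ((map_eq_zero_iff _ (ι_injective M)).1
          (LinearMap.congr_fun hx w)).symm
      · rintro ⟨ψ, rfl⟩
        exact LinearMap.ext fun w => map_zero (ι (cosyz M 0))
    · exact fun _ => ⟨fun _ => ⟨0, rfl⟩, fun _ => rfl⟩
    · exact exact_compRight W (ι_injective _) (exact_ι_diff M 0)
    · cases n <;> exact exact_hom_diff (M := M) (h W hW) _
  · exact ⟨(LinearEquiv.ofInjective _ (ι_injective M)).trans
      (LinearEquiv.ofEq _ _ (exact_ι_diff M 0).linearMap_ker_eq.symm)⟩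

end CInjective

section ZeroIdeal

variable {R : Type u} [CommRing R]

lemma IsGCInjective.of_equiv {C M N : ModuleCat.{u} R} (e : M ≃ₗ[R] N) (h : IsGCInjective R C M) :
    IsGCInjective R C N := by
  obtain ⟨res, ⟨e'⟩⟩ := h
  exact ⟨res, ⟨e.symm.trans e'⟩⟩

lemma lcVanish_bot (i : ℕ) (hi : i ≠ 0) (M : Type u) [AddCommGroup M] [Module R M] :
    LCVanish (⊥ : Ideal R) i M := by
  intro t x
  refine ⟨t + 1, t.le_succ, ?_⟩
  obtain ⟨i, rfl⟩ := Nat.exists_eq_succ_of_ne_zero hi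
  have : Module.Projective R (R ⧸ (⊥ : Ideal R) ^ (t + 1)) :=
    .of_equiv (Submodule.quotEquivOfEqBot _ (Ideal.bot_pow t.succ_ne_zero)).symm
  have := ExtMod.van_of_projective (R := R) (X := R ⧸ (⊥ : Ideal R) ^ (t + 1)) M i
  exact Subsingleton.elim _ _

lemma powTorsion_bot (M : Type u) [AddCommGroup M] [Module R M] :
    powTorsion (⊥ : Ideal R) M = ⊤ := by
  refine eq_top_iff.2 fun x _ => ⟨1, fun r hr => ?_⟩
  rw [pow_one, Ideal.mem_bot] at hr
  rw [hr, zero_smul]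

lemma nonempty_localCohomology_bot_equiv (M : ModuleCat.{u} R) :
    Nonempty ((localCohomology (⊥ : Ideal R) 0).obj M ≃ₗ[R] M) := by
  obtain ⟨e⟩ := (isLC_localCohomology ⊥ 0 M).equiv_powTorsion
  exact ⟨e.trans ((LinearEquiv.ofEq _ _ (powTorsion_bot M)).trans Submodule.topEquiv)⟩

lemma heightWRT_bot [IsNoetherianRing R] [IsLocalRing R] :
    heightWRT R (⊥ : Ideal R) R = ((0 : ℕ∞) : WithBot ℕ∞) := by
  rw [heightWRT_self]
  obtain ⟨p, hp, -⟩ := Ideal.exists_minimalPrimes_le (bot_le (a := IsLocalRing.maximalIdeal R))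
  have := hp.1.1
  have h0 : p.height = 0 := Ideal.height_eq_zero_iff.2 hp
  refine le_antisymm ?_ (le_iInf₂ fun p _ => ?_)
  · refine (iInf₂_le (f := fun (q : PrimeSpectrum R) (_ : (⊥ : Ideal R) ≤ q.asIdeal) =>
      (q.asIdeal.height : WithBot ℕ∞)) ⟨p, this⟩ bot_le).trans_eq ?_
    exact congrArg _ h0
  · exact_mod_cast bot_le (a := p.asIdeal.height)

end ZeroIdeal

section Forward

variable {R : Type u} [CommRing R]

lemma IsSemidualizing.ext_van {C : ModuleCat.{u} R} (hC : IsSemidualizing R C) (i : ℕ) :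
    Subsingleton (ExtMod R C C (i + 1)) :=
  ExtMod.subsingleton_of_ext (hC.2.2 (i + 1) i.succ_pos)

/-- The ring is isomorphic to the endomorphism module of a semidualizing module. -/
def IsSemidualizing.homEquiv {C : ModuleCat.{u} R} (hC : IsSemidualizing R C) :
    R ≃ₗ[R] (C →ₗ[R] C) :=
  LinearEquiv.ofBijective (LinearMap.lsmul R C) hC.2.1

lemma ext_cInjective_van [IsNoetherianRing R] {C : ModuleCat.{u} R} (hC : IsSemidualizing R C)
    {V W : ModuleCat.{u} R} (hV : IsCInjective R C V) (hW : IsCInjective R C W) (i : ℕ) :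
    Subsingleton (ExtMod R V W (i + 1)) := by
  obtain ⟨I, hI, ⟨e⟩⟩ := hV
  obtain ⟨J, hJ, ⟨e'⟩⟩ := hW
  have := hC.1
  exact ExtMod.van_congr e.symm e'.symm (ext_hom_hom_van C C I J hC.ext_van hI hJ i)

lemma gcinjDim_localCohomology_bot_ne_top [IsNoetherianRing R] {C : ModuleCat.{u} R} (hC : IsDualizing R C) :
    gcinjDim R C ((localCohomology (⊥ : Ideal R) 0).obj (ModuleCat.of R R)) ≠ ⊤ := by
  obtain ⟨e⟩ := nonempty_localCohomology_bot_equiv (ModuleCat.of R R)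
  obtain ⟨g, hg⟩ := (coresDim_ne_top_iff _ _).1 hC.2
  refine (coresDim_ne_top_iff _ _).2 ⟨g, ?_⟩
  refine HasCoresDimLE.of_equiv (M := ModuleCat.of R (C →ₗ[R] C))
    (fun _ _ => IsGCInjective.of_equiv) (hC.1.homEquiv.symm.trans e.symm) ?_
  exact (hasCoresDimLE_hom C g C hg hC.1.ext_van).mono fun X hX =>
    isGCInjective_of_ext_van hX fun W hW => ext_cInjective_van hC.1 hW hX

lemma isRelativeCM_bot [Nontrivial R] : IsRelativeCM R (⊥ : Ideal R) (ModuleCat.of R R) := by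
  obtain ⟨e⟩ := nonempty_localCohomology_bot_equiv (ModuleCat.of R R)
  refine ⟨0, e.toEquiv.nontrivial, fun i hi => ?_⟩
  by_contra h0
  exact not_subsingleton_iff_nontrivial.2 hi
    ((isLC_localCohomology ⊥ i _).subsingleton_iff.2 (lcVanish_bot i h0 _))

end Forward

section Reduction

open scoped Pointwise

variable {R : Type u} [CommRing R]

lemma nonempty_equiv_of_exact_smul {A A' B B' : Type u} [AddCommGroup A] [Module R A]
    [AddCommGroup A'] [Module R A'] [AddCommGroup B] [Module R B] [AddCommGroup B'] [Module R B']
    {y : R} {f : A →ₗ[R] A'} {g : B →ₗ[R] B'}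
    (hf : Function.Exact (y • LinearMap.id : A →ₗ[R] A) f) (hf' : Function.Surjective f)
    (hg : Function.Exact (y • LinearMap.id : B →ₗ[R] B) g) (hg' : Function.Surjective g)
    (e : A ≃ₗ[R] B) : Nonempty (A' ≃ₗ[R] B') := by
  refine ⟨(f.quotKerEquivOfSurjective hf').symm.trans
    ((Submodule.Quotient.equiv _ _ e ?_).trans (g.quotKerEquivOfSurjective hg'))⟩
  ext x
  rw [Submodule.mem_map, LinearMap.mem_ker, hg x]
  constructor
  · rintro ⟨z, hz, rfl⟩
    obtain ⟨w, rfl⟩ := (hf z).1 hz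
    exact ⟨e w, by simp⟩
  · rintro ⟨z, rfl⟩
    exact ⟨y • e.symm z, (hf _).2 ⟨e.symm z, rfl⟩, by simp⟩

lemma ExtMod.pre_smul_id (y : R) (A X : Type u) [AddCommGroup A] [Module R A] [AddCommGroup X]
    [Module R X] (i : ℕ) :
    pre (y • LinearMap.id : A →ₗ[R] A) X i = y • LinearMap.id := by
  ext x
  rw [pre_smul, pre_id, LinearMap.smul_apply, LinearMap.id_apply]

lemma ExtMod.post_smul_id (y : R) (A X : Type u) [AddCommGroup A] [Module R A] [AddCommGroup X]
    [Module R X] (i : ℕ) :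
    post X (y • LinearMap.id : A →ₗ[R] A) i = y • LinearMap.id := by
  ext x
  rw [post_smul, post_id, LinearMap.smul_apply, LinearMap.id_apply]

lemma ExtMod.smul_eq_zero_left {N : Type u} [AddCommGroup N] [Module R N] {y : R}
    (hy : ∀ x : N, y • x = 0) (X : Type u) [AddCommGroup X] [Module R X] (i : ℕ)
    (x : ExtMod R N X i) : y • x = 0 := by
  have h0 : (y • LinearMap.id : N →ₗ[R] N) = (0 : R) • LinearMap.id := by
    ext x
    simp [hy]
  have := pre_smul y (LinearMap.id : N →ₗ[R] N) i x
  rw [h0, pre_smul, zero_smul, pre_id] at this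
  exact this.symm

lemma IsSemidualizing.eq_zero_of_smul {C : ModuleCat.{u} R} (hC : IsSemidualizing R C) {r : R}
    (hr : ∀ c : C, r • c = 0) : r = 0 :=
  hC.2.1.1 (by
    ext c
    rw [map_zero]
    exact hr c)

lemma IsSemidualizing.smul_injective_of_hom [IsNoetherianRing R] {C : ModuleCat.{u} R}
    (hC : IsSemidualizing R C) (B : Type u) [AddCommGroup B] [Module R B] [Module.Finite R B]
    {y : R} (hy : ∀ φ : C →ₗ[R] B, y • φ = 0 → φ = 0) :
    Function.Injective (y • LinearMap.id : B →ₗ[R] B) := by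
  rw [← LinearMap.ker_eq_bot]
  set K := LinearMap.ker (y • LinearMap.id : B →ₗ[R] B) with hK
  have := hC.1
  have h0 : Subsingleton (C →ₗ[R] K) := subsingleton_of_forall_eq 0 fun φ => by
    have : K.subtype.comp φ = 0 := hy _ (LinearMap.ext fun c => (φ c).2)
    ext c
    exact LinearMap.congr_fun this c
  obtain ⟨r, hr, hr'⟩ := IsSMulRegular.subsingleton_linearMap_iff.1 h0
  obtain rfl := hC.eq_zero_of_smul (Module.mem_annihilator.1 hr)
  refine (Submodule.eq_bot_iff _).2 fun x hx => ?_
  exact congrArg Subtype.val (@hr' ⟨x, hx⟩ 0 (by simp))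

/-- Properties of the reduction `A` of the ring by a regular sequence of length `j` in the maximal
ideal, relative to a semidualizing module `C`. -/
structure IsReduction [IsLocalRing R] (C : Type u) [AddCommGroup C] [Module R C] (j : ℕ)
    (A : Type u) [AddCommGroup A] [Module R A] : Prop where
  finite : Module.Finite R A
  ext_hom_van : ∀ (J : Type u) [AddCommGroup J] [Module R J], Module.Injective R J →
    ∀ i, Subsingleton (ExtMod R A (C →ₗ[R] J) (i + 1))
  ext_van : ∀ (X : Type u) [AddCommGroup X] [Module R X], ∀ i, j < i → Subsingleton (ExtMod R A X i)
  ext_self : Nonempty (ExtMod R A R j ≃ₗ[R] A)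
  ext_tensor_van : ∀ i, Subsingleton (ExtMod R C (C ⊗[R] A) (i + 1))
  hom_tensor : Nonempty ((C →ₗ[R] C ⊗[R] A) ≃ₗ[R] A)
  ext_residue_van_of_tensor : ∀ N,
    (∀ i ≥ N, Subsingleton (ExtMod R (R ⧸ IsLocalRing.maximalIdeal R) (C ⊗[R] A) i)) →
    ∀ i ≥ N, Subsingleton (ExtMod R (R ⧸ IsLocalRing.maximalIdeal R) C i)
  ext_residue_hom_van : ∀ (J : Type u) [AddCommGroup J] [Module R J], Module.Injective R J →
    ∀ i, j < i → Subsingleton (ExtMod R (R ⧸ IsLocalRing.maximalIdeal R) (A →ₗ[R] J) i)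

variable [IsLocalRing R]

lemma IsReduction.self {C : ModuleCat.{u} R} (hC : IsSemidualizing R C) :
    IsReduction (R := R) C 0 R where
  finite := inferInstance
  ext_hom_van J _ _ _ i := ExtMod.van_of_projective _ i
  ext_van X _ _ i hi := by
    obtain ⟨i, rfl⟩ := Nat.exists_eq_succ_of_ne_zero hi.ne'
    exact ExtMod.van_of_projective _ i
  ext_self := ⟨(ExtMod.zeroEquiv R R).trans (LinearMap.ringLmapEquivSelf R R R)⟩
  ext_tensor_van i := ExtMod.van_post _ (TensorProduct.rid R C).symm (hC.ext_van i)
  hom_tensor := ⟨(LinearEquiv.congrRight (TensorProduct.rid R C)).trans hC.homEquiv.symm⟩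
  ext_residue_van_of_tensor N h i hi := ExtMod.van_post _ (TensorProduct.rid R C) (h i hi)
  ext_residue_hom_van J _ _ hJ i hi := by
    obtain ⟨i, rfl⟩ := Nat.exists_eq_succ_of_ne_zero hi.ne'
    exact ExtMod.van_of_injective _ (hJ.of_equiv (LinearMap.ringLmapEquivSelf R R J).symm) i

theorem IsReduction.succ [IsNoetherianRing R] {C : ModuleCat.{u} R} (hC : IsSemidualizing R C)
    {A A' : Type u} [AddCommGroup A] [Module R A] [AddCommGroup A'] [Module R A'] {j : ℕ}
    (h : IsReduction (R := R) C j A) {y : R} (hy : y ∈ IsLocalRing.maximalIdeal R) {g : A →ₗ[R] A'}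
    (hs : IsSES (y • LinearMap.id) g) : IsReduction (R := R) C (j + 1) A' := by
  have := h.finite
  have hCf := hC.1
  have hA' : Module.Finite R A' := .of_surjective g hs.surj
  have htens : (y • LinearMap.id : A →ₗ[R] A).lTensor C = y • LinearMap.id := by
    rw [LinearMap.lTensor_smul, LinearMap.lTensor_id]
  have hinj : Function.Injective (y • LinearMap.id : C ⊗[R] A →ₗ[R] C ⊗[R] A) := by
    refine hC.smul_injective_of_hom _ fun φ hφ => ?_
    obtain ⟨e⟩ := h.hom_tensor
    apply e.injective
    rw [map_zero]
    apply hs.inj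
    rw [map_zero, LinearMap.smul_apply, LinearMap.id_apply, ← map_smul, hφ, map_zero]
  have hs' : IsSES (y • LinearMap.id : C ⊗[R] A →ₗ[R] C ⊗[R] A) (g.lTensor C) :=
    ⟨hinj, htens ▸ lTensor_exact C hs.exact hs.surj, LinearMap.lTensor_surjective C hs.surj⟩
  refine ⟨hA', ?_, ?_, ?_, ?_, ?_, ?_, ?_⟩
  · intro J _ _ hJ i
    cases i with
    | zero =>
      refine ExtMod.van_one_of_extend hs (h.ext_hom_van J hJ 0) fun φ => ?_
      obtain ⟨k, hk⟩ := hJ.extend _ hinj (TensorProduct.lift φ.flip)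
      refine ⟨(TensorProduct.curry k).flip, LinearMap.ext fun a => LinearMap.ext fun c => ?_⟩
      simpa using LinearMap.congr_fun hk (c ⊗ₜ a)
    | succ i => exact ExtMod.van_pre₃ hs _ (h.ext_hom_van J hJ _) (h.ext_hom_van J hJ _)
  · intro X _ _ i hi
    obtain ⟨i, rfl⟩ := Nat.exists_eq_succ_of_ne_zero (Nat.ne_zero_of_lt hi)
    exact ExtMod.van_pre₃ hs _ (h.ext_van X i (by lia)) (h.ext_van X (i + 1) (by lia))
  · obtain ⟨e⟩ := h.ext_self
    have := ExtMod.exact_pre_δ hs R j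
    rw [ExtMod.pre_smul_id] at this
    exact nonempty_equiv_of_exact_smul this
      (surjective_of_exact (ExtMod.exact_δ_pre hs R j) (h.ext_van R _ j.lt_succ_self))
      hs.exact hs.surj e
  · exact fun i => ExtMod.van_post₃ _ hs' (h.ext_tensor_van i) (h.ext_tensor_van (i + 1))
  · obtain ⟨e⟩ := h.hom_tensor
    have := hs'.compRight C (h.ext_tensor_van 0)
    exact nonempty_equiv_of_exact_smul this.exact this.surj hs.exact hs.surj e
  · intro N hN
    refine h.ext_residue_van_of_tensor N fun i hi => subsingleton_of_forall_eq 0 fun x => ?_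
    obtain ⟨z, rfl⟩ := surjective_of_exact (ExtMod.exact_post _ hs' i) (hN i hi) x
    rw [ExtMod.post_smul_id]
    refine ExtMod.smul_eq_zero_left (fun r => ?_) _ _ z
    obtain ⟨r, rfl⟩ := Ideal.Quotient.mk_surjective r
    rw [← Ideal.Quotient.mk_eq_mk, ← Submodule.Quotient.mk_smul, Submodule.Quotient.mk_eq_zero]
    exact Ideal.mul_mem_right _ _ hy
  · intro J _ _ hJ i hi
    obtain ⟨i, rfl⟩ := Nat.exists_eq_succ_of_ne_zero (Nat.ne_zero_of_lt hi)
    exact ExtMod.van_post₁ _ (hs.lcomp J (ExtMod.van_of_injective _ hJ 0))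
      (h.ext_residue_hom_van J hJ i (by lia)) (h.ext_residue_hom_van J hJ _ (by lia))

lemma IsReduction.of_isWeaklyRegular [IsNoetherianRing R] {C : ModuleCat.{u} R}
    (hC : IsSemidualizing R C) (rs : List R) (hrs : ∀ r ∈ rs, r ∈ IsLocalRing.maximalIdeal R)
    (A : Type u) [AddCommGroup A] [Module R A] {j : ℕ} (h : IsReduction (R := R) C j A)
    (hA : RingTheory.Sequence.IsWeaklyRegular A rs) :
    ∃ A' : ModuleCat.{u} R, IsReduction (R := R) C (j + rs.length) A' ∧
      Nonempty (A' ≃ₗ[R] A ⧸ (Ideal.ofList rs • ⊤ : Submodule R A)) := by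
  induction rs generalizing A j with
  | nil =>
    refine ⟨ModuleCat.of R A, h, ⟨(Submodule.quotEquivOfEqBot _ ?_).symm⟩⟩
    rw [Ideal.ofList_nil, Submodule.bot_smul]
  | cons r rs ih =>
    obtain ⟨h1, h2⟩ := (RingTheory.Sequence.isWeaklyRegular_cons_iff _ _ _).1 hA
    have hs : IsSES (r • LinearMap.id) (Submodule.mkQ (r • ⊤ : Submodule R A)) := by
      refine ⟨h1, fun x => ?_, Submodule.mkQ_surjective _⟩
      rw [Submodule.mkQ_apply, Submodule.Quotient.mk_eq_zero, Submodule.mem_smul_pointwise_iff_exists]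
      simp
    obtain ⟨A', hA', ⟨e⟩⟩ := ih (fun s hs => hrs s (List.mem_cons_of_mem _ hs)) (QuotSMulTop r A)
      (h.succ hC (hrs r List.mem_cons_self) hs) h2
    refine ⟨A', ?_, ⟨e.trans
      (Submodule.quotOfListConsSMulTopEquivQuotSMulTopInner A r rs).symm⟩⟩
    rwa [List.length_cons, add_comm rs.length, ← add_assoc]

/-- A Cohen-Macaulay local ring has a reduction of finite length. -/
theorem exists_isReduction [IsNoetherianRing R] (h : IsCohenMacaulayLocalRing R)
    {C : ModuleCat.{u} R} (hC : IsSemidualizing R C) :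
    ∃ (d : ℕ) (I : Ideal R) (A : ModuleCat.{u} R), (IsLocalRing.maximalIdeal R).height = d ∧
      IsReduction (R := R) C d A ∧ Nonempty (A ≃ₗ[R] R ⧸ I) ∧
      IsPowTorsion (IsLocalRing.maximalIdeal R) A := by
  obtain ⟨d, hd⟩ := ENat.ne_top_iff_exists.1 (Ideal.height_ne_top
    (IsLocalRing.maximalIdeal.isMaximal R).ne_top)
  obtain ⟨rs, hl, hrs, hreg⟩ := exists_isRegular_of_ext_van (IsLocalRing.maximalIdeal R)
    (IsLocalRing.maximalIdeal.isMaximal R).ne_top d fun i hi => h.ext_residue_van i (by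
      rw [← hd]
      exact_mod_cast hi)
  obtain ⟨A, hA, ⟨e⟩⟩ := (IsReduction.self hC).of_isWeaklyRegular hC rs hrs R hreg.1
  rw [zero_add, hl] at hA
  refine ⟨d, (Ideal.ofList rs • ⊤ : Submodule R R), A, hd.symm, hA, ⟨e⟩, ?_⟩
  have hle : IsLocalRing.maximalIdeal R ≤ (Ideal.ofList rs).radical := by
    rw [Ideal.radical_eq_sInf]
    refine le_sInf fun p ⟨hp, hp'⟩ => ?_
    by_contra hlt
    have hpm : p < IsLocalRing.maximalIdeal R :=
      (IsLocalRing.le_maximalIdeal hp'.ne_top).lt_of_not_ge hlt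
    have h1 := length_le_height_of_isRegular rs hreg p fun r hr =>
      hp (Ideal.subset_span hr)
    have h2 := Ideal.height_strict_mono_of_isPrime hpm
    rw [hl, hd] at h1
    exact absurd h1 (not_le.2 h2)
  obtain ⟨s, hs⟩ := Ideal.exists_pow_le_of_le_radical_of_fg hle (IsNoetherian.noetherian _)
  refine ⟨s, fun r hr x => e.injective ?_⟩
  rw [map_smul, map_zero]
  obtain ⟨z, hz⟩ := Submodule.mkQ_surjective _ (e x)
  rw [← hz, ← map_smul, Submodule.mkQ_apply, Submodule.Quotient.mk_eq_zero]
  exact Submodule.smul_mem_smul (hs hr) trivial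

end Reduction

section ProperResolutions

variable {R : Type u} [CommRing R]

/-- `M` has a partial proper resolution with `N` terms by `C`-injective modules. -/
def HasProperRes (C : ModuleCat.{u} R) : ℕ → ModuleCat.{u} R → Prop
  | 0, _ => True
  | N + 1, M => ∃ (K Y : ModuleCat.{u} R) (f : K →ₗ[R] Y) (p : Y →ₗ[R] M), IsSES f p ∧
      IsCInjective R C Y ∧ (∀ W, IsCInjective R C W → Subsingleton (ExtMod R W K 1)) ∧
      HasProperRes C N K

variable {C : ModuleCat.{u} R}

lemma IsSES.trans_equiv {A B D D' : Type u} [AddCommGroup A] [Module R A] [AddCommGroup B]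
    [Module R B] [AddCommGroup D] [Module R D] [AddCommGroup D'] [Module R D'] {f : A →ₗ[R] B}
    {g : B →ₗ[R] D} (h : IsSES f g) (e : D ≃ₗ[R] D') : IsSES f (e.toLinearMap.comp g) :=
  ⟨h.inj, fun x => by simp [← h.exact x], e.surjective.comp h.surj⟩

lemma HasProperRes.of_equiv {N : ℕ} {M M' : ModuleCat.{u} R} (e : M ≃ₗ[R] M')
    (h : HasProperRes C N M) : HasProperRes C N M' := by
  cases N with
  | zero => trivial
  | succ N =>
    obtain ⟨K, Y, f, p, hs, h⟩ := h
    exact ⟨K, Y, f, e.toLinearMap.comp p, hs.trans_equiv e, h⟩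

lemma IsCInjective.of_subsingleton (M : ModuleCat.{u} R) [Subsingleton M] :
    IsCInjective R C M :=
  ⟨ModuleCat.of R PUnit, ⟨fun _ _ _ _ _ _ _ _ _ => ⟨0, fun _ => rfl⟩⟩,
    ⟨⟨0, 0, fun _ => Subsingleton.elim _ _, fun _ => LinearMap.ext fun _ => rfl⟩⟩⟩

lemma IsCInjective.prod {M M' : ModuleCat.{u} R} (h : IsCInjective R C M)
    (h' : IsCInjective R C M') : IsCInjective R C (ModuleCat.of R (M × M')) := by
  obtain ⟨I, hI, ⟨e⟩⟩ := h
  obtain ⟨J, hJ, ⟨e'⟩⟩ := h'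
  refine ⟨ModuleCat.of R (I × J), ⟨fun X Y _ _ _ _ f hf g => ?_⟩,
    ⟨(e.prodCongr e').trans (LinearMap.prodEquiv R)⟩⟩
  obtain ⟨k, hk⟩ := hI.extend f hf ((LinearMap.fst R I J).comp g)
  obtain ⟨k', hk'⟩ := hJ.extend f hf ((LinearMap.snd R I J).comp g)
  exact ⟨k.prod k', fun x => Prod.ext (LinearMap.congr_fun hk x) (LinearMap.congr_fun hk' x)⟩

lemma HasProperRes.of_subsingleton (N : ℕ) (M : ModuleCat.{u} R) [Subsingleton M] :
    HasProperRes C N M := by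
  induction N with
  | zero => trivial
  | succ N ih =>
    exact ⟨M, M, LinearMap.id, LinearMap.id,
      ⟨Function.injective_id, fun _ => iff_of_true (Subsingleton.elim _ _) ⟨_, rfl⟩,
        Function.surjective_id⟩, .of_subsingleton M,
      fun W _ => ExtMod.van_of_subsingleton_right W 1, ih⟩

lemma HasProperRes.middle (N : ℕ) {A B D : ModuleCat.{u} R} {a : A →ₗ[R] B} {b : B →ₗ[R] D}
    (h : IsSES a b) (hA : ∀ W, IsCInjective R C W → Subsingleton (ExtMod R W A 1))
    (pA : HasProperRes C N A) (pD : HasProperRes C N D) : HasProperRes C N B := by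
  induction N generalizing A B D with
  | zero => trivial
  | succ N ih =>
    obtain ⟨KA, YA, fA, gA, hsA, hYA, hKA, pKA⟩ := pA
    obtain ⟨KD, YD, fD, gD, hsD, hYD, hKD, pKD⟩ := pD
    obtain ⟨ψ, hψ⟩ := ExtMod.lift_of_van h (hA YD hYD) gD
    have hbψ (y : YD) : b (ψ y) = gD y := LinearMap.congr_fun hψ y
    have hba (x : A) : b (a x) = 0 := h.exact.apply_apply_eq_zero x
    let g : YA × YD →ₗ[R] B := (a.comp gA).coprod ψ
    have hg : Function.Surjective g := fun x => by
      obtain ⟨y, hy⟩ := hsD.surj (b x)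
      obtain ⟨z, hz⟩ := (h.exact (x - ψ y)).1 (by rw [map_sub, hbψ, hy, sub_self])
      obtain ⟨w, rfl⟩ := hsA.surj z
      exact ⟨(w, y), by simp [g, hz]⟩
    have hsnd (x : LinearMap.ker g) : gD x.1.2 = 0 := by
      have h0 : a (gA x.1.1) + ψ x.1.2 = 0 := x.2
      have := congrArg b h0
      rwa [map_add, hba, zero_add, hbψ, map_zero] at this
    obtain ⟨π, hπ⟩ := (exact_compRight (LinearMap.ker g) hsD.inj hsD.exact
      ((LinearMap.snd R YA YD).comp (LinearMap.ker g).subtype)).1 (LinearMap.ext hsnd)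
    have hπ' (x : LinearMap.ker g) : fD (π x) = x.1.2 := LinearMap.congr_fun hπ x
    let ι : KA →ₗ[R] LinearMap.ker g := ((LinearMap.inl R YA YD).comp fA).codRestrict _ fun k => by
      simp [g, hsA.exact.apply_apply_eq_zero]
    have hs : IsSES ι π := by
      refine ⟨fun x y hxy => hsA.inj (congrArg (fun z => z.1.1) hxy), fun x => ?_, fun k => ?_⟩
      · rw [← map_eq_zero_iff _ hsD.inj, hπ']
        constructor
        · intro h0
          have hx' : a (gA x.1.1) + ψ x.1.2 = 0 := x.2
          have hx : a (gA x.1.1) = 0 := by rwa [h0, map_zero, add_zero] at hx'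
          obtain ⟨k, hk⟩ := (hsA.exact x.1.1).1 (h.inj (hx.trans (map_zero a).symm))
          exact ⟨k, Subtype.ext (Prod.ext hk h0.symm)⟩
        · rintro ⟨k, rfl⟩
          rfl
      · obtain ⟨z, hz⟩ := (h.exact (ψ (fD k))).1 (by
          rw [hbψ, hsD.exact.apply_apply_eq_zero])
        obtain ⟨w, rfl⟩ := hsA.surj z
        exact ⟨⟨(-w, fD k), by simp [g, hz]⟩, hsD.inj (hπ' _)⟩
    exact ⟨ModuleCat.of R (LinearMap.ker g), ModuleCat.of R (YA × YD), _, g, .ker g hg,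
      hYA.prod hYD, fun W hW => ExtMod.van_post₂ _ hs (hKA W hW) (hKD W hW),
      ih (B := ModuleCat.of R (LinearMap.ker g)) hs hKA pKA pKD⟩

variable [IsNoetherianRing R]

lemma IsGCInjective.hasProperRes (hC : IsSemidualizing R C) {M : ModuleCat.{u} R}
    (h : IsGCInjective R C M) (N : ℕ) : HasProperRes C N M := by
  obtain ⟨res, ⟨e⟩⟩ := h
  suffices H : ∀ i : ℤ, -1 ≤ i → HasProperRes C N (ModuleCat.of R (LinearMap.ker (res.d i))) from
    (H (-1) le_rfl).of_equiv e.symm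
  induction N with
  | zero => exact fun _ _ => trivial
  | succ N ih =>
    intro i hi
    have hY := res.cinj_pos (i + 1 + 1) (by lia)
    let p : res.Y (i + 1 + 1) →ₗ[R] LinearMap.ker (res.d i) :=
      (res.d (i + 1)).codRestrict _ fun x => (res.exact i).apply_apply_eq_zero x
    have hs : IsSES (LinearMap.ker (res.d (i + 1))).subtype p := by
      refine ⟨Subtype.val_injective, fun x => ?_, fun x => ?_⟩
      · refine ⟨fun h0 => ⟨⟨x, congrArg Subtype.val h0⟩, rfl⟩, ?_⟩
        rintro ⟨y, rfl⟩
        exact Subtype.ext y.2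
      · obtain ⟨y, hy⟩ := (res.exact i x).1 x.2
        exact ⟨y, Subtype.ext hy⟩
    refine ⟨ModuleCat.of R (LinearMap.ker (res.d (i + 1))), res.Y (i + 1 + 1), _, p, hs, hY,
      fun W hW => ?_, ih (i + 1) (by lia)⟩
    refine ExtMod.van_one_of_lift hs (ext_cInjective_van hC hW hY 0) fun φ => ?_
    obtain ⟨ψ, hψ⟩ := (res.homExact W hW i ((LinearMap.ker (res.d i)).subtype.comp φ)).1
      (LinearMap.ext fun w => (φ w).2)
    exact ⟨ψ, LinearMap.ext fun w => Subtype.ext (LinearMap.congr_fun hψ w)⟩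

/-- A module of finite `G_C`-injective dimension is approximated by a module of finite
`C`-injective dimension. -/
theorem exists_approximation (hC : IsSemidualizing R C) (g N : ℕ) {H : ModuleCat.{u} R}
    (h : HasCoresDimLE R (IsGCInjective R C) g H) :
    ∃ (K L : ModuleCat.{u} R) (f : K →ₗ[R] L) (p : L →ₗ[R] H), IsSES f p ∧ HasProperRes C N K ∧
      (∀ W, IsCInjective R C W → Subsingleton (ExtMod R W K 1)) ∧
      HasCoresDimLE R (IsCInjective R C) g L := by
  have trivial_case (g N : ℕ) (H : ModuleCat.{u} R) (hH : Subsingleton H) :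
      ∃ (K L : ModuleCat.{u} R) (f : K →ₗ[R] L) (p : L →ₗ[R] H), IsSES f p ∧ HasProperRes C N K ∧
        (∀ W, IsCInjective R C W → Subsingleton (ExtMod R W K 1)) ∧
        HasCoresDimLE R (IsCInjective R C) g L :=
    ⟨H, H, LinearMap.id, LinearMap.id, ⟨Function.injective_id,
      fun _ => iff_of_true (Subsingleton.elim _ _) ⟨_, rfl⟩, Function.surjective_id⟩,
      .of_subsingleton N H, fun W _ => ExtMod.van_of_subsingleton_right W 1,
      by cases g <;> exact .inl hH⟩
  induction g generalizing H N with
  | zero =>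
    obtain hH | hH := h
    · exact trivial_case 0 N H hH
    · obtain ⟨K, Y, f, p, hs, hY, hK, hK'⟩ := hH.hasProperRes hC (N + 1)
      exact ⟨K, Y, f, p, hs, hK', hK, .inr hY⟩
  | succ g ih =>
    obtain hH | ⟨G, i, hG, hi, hq⟩ := h
    · exact trivial_case (g + 1) N H hH
    obtain ⟨K₁, L₁, f₁, p₁, hs₁, pK₁, hK₁, hL₁⟩ := ih (N + 1) hq
    let q : G →ₗ[R] ModuleCat.of R (G ⧸ LinearMap.range i) := (LinearMap.range i).mkQ
    have hs₂ : IsSES i q := IsSES.range i hi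
    let P := LinearMap.ker (q.coprod (-p₁))
    have hP (x : G × L₁) : x ∈ P ↔ q x.1 = p₁ x.2 := by
      simp [P, ← sub_eq_add_neg, sub_eq_zero]
    let a : K₁ →ₗ[R] P := ((LinearMap.inr R G L₁).comp f₁).codRestrict _ fun k =>
      (hP _).2 ((map_zero q).trans (hs₁.exact.apply_apply_eq_zero k).symm)
    have hab : IsSES a ((LinearMap.fst R G L₁).comp P.subtype) := by
      refine ⟨fun x y hxy => hs₁.inj (congrArg (fun z => z.1.2) hxy), fun x => ⟨fun h0 => ?_, ?_⟩,
        fun x => ?_⟩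
      · have h0 : x.1.1 = 0 := h0
        obtain ⟨k, hk⟩ := (hs₁.exact x.1.2).1 (by rw [← (hP _).1 x.2, h0, map_zero])
        exact ⟨k, Subtype.ext (Prod.ext h0.symm hk)⟩
      · rintro ⟨k, rfl⟩
        rfl
      · obtain ⟨y, hy⟩ := hs₁.surj (q x)
        exact ⟨⟨(x, y), (hP _).2 hy.symm⟩, rfl⟩
    obtain ⟨K, Y, f, p, hs, hY, hK, hK'⟩ := HasProperRes.middle (B := ModuleCat.of R P) (N + 1)
      hab hK₁ pK₁ (hG.hasProperRes hC (N + 1))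
    have hpf (k : K) : p (f k) = 0 := hs.exact.apply_apply_eq_zero k
    let s : Y →ₗ[R] L₁ := ((LinearMap.snd R G L₁).comp P.subtype).comp p
    have hs_surj : Function.Surjective s := fun y => by
      obtain ⟨x, hx⟩ := hs₂.surj (p₁ y)
      obtain ⟨z, hz⟩ := hs.surj ⟨(x, y), (hP _).2 hx⟩
      exact ⟨z, congrArg (fun z => z.1.2) hz⟩
    let r : LinearMap.ker s →ₗ[R] G :=
      (((LinearMap.fst R G L₁).comp P.subtype).comp p).comp (LinearMap.ker s).subtype
    obtain ⟨t, ht⟩ := (exact_compRight (LinearMap.ker s) hs₂.inj hs₂.exact r).1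
      (LinearMap.ext fun y => ((hP _).1 (p y.1).2).trans
        ((congrArg p₁ y.2).trans (map_zero p₁)))
    have ht' (y : LinearMap.ker s) : i (t y) = (p y.1).1.1 := LinearMap.congr_fun ht y
    let F : K →ₗ[R] LinearMap.ker s := f.codRestrict _ fun k =>
      congrArg (fun z : P => z.1.2) (hpf k)
    refine ⟨K, ModuleCat.of R (LinearMap.ker s), F, t, ⟨fun x y hxy => hs.inj
      (congrArg Subtype.val hxy), fun y => ?_, fun x => ?_⟩, hK', hK,
      .inr ⟨Y, (LinearMap.ker s).subtype, hY, Subtype.val_injective, ?_⟩⟩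
    · rw [← map_eq_zero_iff _ hi, ht']
      constructor
      · intro h0
        obtain ⟨k, hk⟩ := (hs.exact y.1).1 (Subtype.ext (Prod.ext h0 y.2))
        exact ⟨k, Subtype.ext hk⟩
      · rintro ⟨k, rfl⟩
        exact congrArg (fun z : P => z.1.1) (hpf k)
    · obtain ⟨y, hy⟩ := hs.surj ⟨(i x, 0), (hP _).2 (by
        rw [map_zero]
        exact hs₂.exact.apply_apply_eq_zero x)⟩
      refine ⟨⟨y, congrArg (fun z : P => z.1.2) hy⟩, hi ?_⟩
      rw [ht']
      exact congrArg (fun z : P => z.1.1) hy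
    · exact hL₁.of_equiv (fun _ _ => IsCInjective.of_equiv) (IsSES.ker s hs_surj).quotEquiv.symm

end ProperResolutions

section Backward

variable {R : Type u} [CommRing R] {C : ModuleCat.{u} R} {j : ℕ}
  {A : Type u} [AddCommGroup A] [Module R A]

lemma exists_section_of_cyclic {I : Ideal R} (e : A ≃ₗ[R] R ⧸ I) (L : Type u) [AddCommGroup L]
    [Module R L] (F : (A →ₗ[R] L) →ₗ[R] A) (hF : Function.Surjective F) :
    ∃ S : A →ₗ[R] A →ₗ[R] L, F.comp S = LinearMap.id := by
  obtain ⟨φ, hφ⟩ := hF (e.symm (Submodule.Quotient.mk 1))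
  have hI : I ≤ LinearMap.ker (LinearMap.toSpanSingleton R (A →ₗ[R] L) φ) := fun r hr => by
    ext x
    have : r • x = 0 := e.injective (by
      rw [map_smul, map_zero]
      obtain ⟨z, hz⟩ := Submodule.Quotient.mk_surjective _ (e x)
      rw [← hz, ← Submodule.Quotient.mk_smul, Submodule.Quotient.mk_eq_zero]
      exact Ideal.mul_mem_right _ _ hr)
    rw [LinearMap.toSpanSingleton_apply, LinearMap.smul_apply, ← map_smul, this, map_zero]
    rfl
  refine ⟨(I.liftQ _ hI).comp e.toLinearMap, LinearMap.ext fun x => ?_⟩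
  obtain ⟨z, rfl⟩ := e.symm.surjective x
  obtain ⟨r, rfl⟩ := Submodule.Quotient.mk_surjective _ z
  simp only [LinearMap.comp_apply, LinearEquiv.coe_coe, LinearEquiv.apply_symm_apply,
    Submodule.liftQ_apply, LinearMap.toSpanSingleton_apply, map_smul, hφ, LinearMap.id_apply]
  rw [← map_smul, ← Submodule.Quotient.mk_smul, smul_eq_mul, mul_one]

variable [IsLocalRing R]

lemma IsReduction.ext_cInjective_van (h : IsReduction (R := R) C j A) {W : ModuleCat.{u} R}
    (hW : IsCInjective R C W) (i : ℕ) : Subsingleton (ExtMod R A W (i + 1)) := by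
  obtain ⟨J, hJ, ⟨e⟩⟩ := hW
  exact ExtMod.van_post A e.symm (h.ext_hom_van J hJ i)

lemma IsReduction.ext_van_of_hasProperRes (h : IsReduction (R := R) C j A) (N : ℕ)
    {K : ModuleCat.{u} R} (hK : HasProperRes C N K) (i : ℕ) (hi : j < i + 1 + N) :
    Subsingleton (ExtMod R A K (i + 1)) := by
  induction N generalizing K i with
  | zero => exact h.ext_van K _ hi
  | succ N ih =>
    obtain ⟨K', Y, f, p, hs, hY, -, hK'⟩ := hK
    exact ExtMod.van_post₃ A hs (h.ext_cInjective_van hY i) (ih hK' (i + 1) (by lia))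

/-- Descent along a coresolution by `C`-injective modules. -/
lemma IsReduction.exists_hom_surjective (h : IsReduction (R := R) C j A) (c g : ℕ)
    {L : ModuleCat.{u} R} (hL : HasCoresDimLE R (IsCInjective R C) g L)
    (F : ExtMod R A L c →ₗ[R] A) (hF : Function.Surjective F)
    (hv : ∀ i, c < i → Subsingleton (ExtMod R A L i)) :
    ∃ (g' : ℕ) (L' : ModuleCat.{u} R) (F' : (A →ₗ[R] L') →ₗ[R] A),
      HasCoresDimLE R (IsCInjective R C) g' L' ∧ Function.Surjective F' ∧
      ∀ i, Subsingleton (ExtMod R A L' (i + 1)) := by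
  induction c generalizing g L with
  | zero =>
    exact ⟨g, L, F.comp (ExtMod.zeroEquiv A L).symm.toLinearMap, hL,
      hF.comp (ExtMod.zeroEquiv A L).symm.surjective, fun i => hv _ i.succ_pos⟩
  | succ c ih =>
    have acyclic_case (hL' : ∀ i, Subsingleton (ExtMod R A L (i + 1))) :
        ∃ (g' : ℕ) (L' : ModuleCat.{u} R) (F' : (A →ₗ[R] L') →ₗ[R] A),
          HasCoresDimLE R (IsCInjective R C) g' L' ∧ Function.Surjective F' ∧
          ∀ i, Subsingleton (ExtMod R A L' (i + 1)) := by
      have := hL' c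
      have := hF.subsingleton
      exact ⟨g, L, 0, hL, fun x => ⟨0, Subsingleton.elim _ _⟩, hL'⟩
    have zero_case (h0 : Subsingleton L) := acyclic_case fun i =>
      ExtMod.van_of_subsingleton_right A (i + 1)
    cases g with
    | zero => exact hL.elim zero_case fun hL' => acyclic_case (h.ext_cInjective_van hL')
    | succ g =>
      obtain h0 | ⟨X, f, hX, hf, hq⟩ := hL
      · exact zero_case h0
      have hs := IsSES.range f hf
      refine ih g hq (F.comp (ExtMod.δpost A hs c)) (hF.comp (surjective_of_exact
        (ExtMod.exact_δ_post A hs c) (h.ext_cInjective_van hX c))) fun i hi => ?_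
      obtain ⟨i, rfl⟩ := Nat.exists_eq_succ_of_ne_zero (Nat.ne_zero_of_lt hi)
      exact ExtMod.van_post₃ A hs (h.ext_cInjective_van hX i) (hv _ (by lia))

/-- Adjunction for maps to a `C`-injective module. -/
def homHomEquiv (C A J : Type u) [AddCommGroup C] [Module R C] [AddCommGroup A] [Module R A]
    [AddCommGroup J] [Module R J] : (A →ₗ[R] C →ₗ[R] J) ≃ₗ[R] (C ⊗[R] A →ₗ[R] J) :=
  (TensorProduct.lift.equiv (.id R) A C J).trans
    (LinearEquiv.congrLeft J R (TensorProduct.comm R A C))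

variable [IsNoetherianRing R]

lemma IsReduction.ext_hom_van_of_cInjective (hC : IsSemidualizing R C)
    (h : IsReduction (R := R) C j A) {L : ModuleCat.{u} R} (hL : IsCInjective R C L)
    {E : Type u} [AddCommGroup E] [Module R E] (hE : Module.Injective R E) (i : ℕ) :
    Subsingleton (ExtMod R (A →ₗ[R] L) (C →ₗ[R] E) (i + 1)) := by
  obtain ⟨J, hJ, ⟨e⟩⟩ := hL
  have := hC.1
  exact ExtMod.van_pre ((LinearEquiv.congrRight e).trans (homHomEquiv C A J)).symm _
    (ext_hom_hom_van C (C ⊗[R] A) J E h.ext_tensor_van hJ hE i)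

lemma IsReduction.ext_residue_van_of_cInjective (hC : IsSemidualizing R C)
    (h : IsReduction (R := R) C j A) {L : ModuleCat.{u} R} (hL : IsCInjective R C L) (i : ℕ)
    (hi : j < i) :
    Subsingleton (ExtMod R (R ⧸ IsLocalRing.maximalIdeal R) (C ⊗[R] (A →ₗ[R] L)) i) := by
  obtain ⟨J, hJ, ⟨e⟩⟩ := hL
  obtain ⟨e'⟩ := h.hom_tensor
  have := hC.1
  have e₁ : C ⊗[R] (A →ₗ[R] L) ≃ₗ[R] C ⊗[R] (C ⊗[R] A →ₗ[R] J) :=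
    ((LinearEquiv.congrRight e).trans (homHomEquiv C A J)).lTensor C
  have e₂ : C ⊗[R] (C ⊗[R] A →ₗ[R] J) ≃ₗ[R] ((C →ₗ[R] C ⊗[R] A) →ₗ[R] J) :=
    .ofBijective (homEval C (C ⊗[R] A) J) (homEval_bijective hJ)
  have e₃ : ((C →ₗ[R] C ⊗[R] A) →ₗ[R] J) ≃ₗ[R] (A →ₗ[R] J) := LinearEquiv.congrLeft J R e'
  exact ExtMod.van_post _ (e₁.trans (e₂.trans e₃)).symm (h.ext_residue_hom_van J hJ i hi)

theorem IsReduction.ext_van_of_hasCoresDimLE (hC : IsSemidualizing R C)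
    (h : IsReduction (R := R) C j A) (g : ℕ) {L : ModuleCat.{u} R}
    (hL : HasCoresDimLE R (IsCInjective R C) g L)
    (hv : ∀ i, Subsingleton (ExtMod R A L (i + 1))) :
    (∀ (E : ModuleCat.{u} R), Module.Injective R E → ∀ i,
      Subsingleton (ExtMod R (A →ₗ[R] L) (C →ₗ[R] E) (i + 1))) ∧
    ∀ i, j + g < i →
      Subsingleton (ExtMod R (R ⧸ IsLocalRing.maximalIdeal R) (C ⊗[R] (A →ₗ[R] L)) i) := by
  have zero_case (g : ℕ) (L : ModuleCat.{u} R) (hL : Subsingleton L) :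
      (∀ (E : ModuleCat.{u} R), Module.Injective R E → ∀ i,
        Subsingleton (ExtMod R (A →ₗ[R] L) (C →ₗ[R] E) (i + 1))) ∧
      ∀ i, j + g < i →
        Subsingleton (ExtMod R (R ⧸ IsLocalRing.maximalIdeal R) (C ⊗[R] (A →ₗ[R] L)) i) := by
    have : Subsingleton (A →ₗ[R] L) := ⟨fun φ ψ => LinearMap.ext fun _ => Subsingleton.elim _ _⟩
    have : Subsingleton (C ⊗[R] (A →ₗ[R] L)) := inferInstance
    exact ⟨fun _ _ _ => ExtMod.van_of_subsingleton_left _ _,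
      fun _ _ => ExtMod.van_of_subsingleton_right _ _⟩
  induction g generalizing L with
  | zero =>
    obtain h0 | hL := hL
    · exact zero_case 0 L h0
    · exact ⟨fun E hE i => h.ext_hom_van_of_cInjective hC hL hE i,
        fun i hi => h.ext_residue_van_of_cInjective hC hL i hi⟩
  | succ g ih =>
    obtain h0 | ⟨X, f, hX, hf, hq⟩ := hL
    · exact zero_case (g + 1) L h0
    have hs := IsSES.range f hf
    obtain ⟨ih₁, ih₂⟩ := ih hq fun i =>
      ExtMod.van_post₃ A hs (h.ext_cInjective_van hX i) (hv (i + 1))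
    have hs' := hs.compRight A (hv 0)
    refine ⟨fun E hE i => ExtMod.van_pre₁ hs' _ (h.ext_hom_van_of_cInjective hC hX hE i)
      (ih₁ E hE (i + 1)), fun i hi => ?_⟩
    have hinj : Function.Injective ((f.compRight R (M := A)).lTensor C) := by
      obtain ⟨E, k, hE, hk⟩ := exists_injective_embedding R (C ⊗[R] (A →ₗ[R] L))
      obtain ⟨ψ, hψ⟩ := ExtMod.extend_of_van hs' (ih₁ E hE 0) (TensorProduct.curry k).flip
      refine Function.Injective.of_comp (f := TensorProduct.lift ψ.flip) ?_
      rw [← LinearMap.coe_comp]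
      convert hk
      refine TensorProduct.ext' fun c φ => ?_
      exact LinearMap.congr_fun (LinearMap.congr_fun hψ φ) c
    have hs'' : IsSES ((f.compRight R (M := A)).lTensor C)
        (((LinearMap.range f).mkQ.compRight R (M := A)).lTensor C) :=
      ⟨hinj, lTensor_exact C hs'.exact hs'.surj, LinearMap.lTensor_surjective C hs'.surj⟩
    obtain ⟨i, rfl⟩ := Nat.exists_eq_succ_of_ne_zero (Nat.ne_zero_of_lt hi)
    exact ExtMod.van_post₁ _ hs'' (ih₂ i (by lia))
      (h.ext_residue_van_of_cInjective hC hX _ (by lia))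

theorem injDim_ne_top_of_gcinjDim_ne_top (hCM : IsCohenMacaulayLocalRing R)
    (hC : IsSemidualizing R C) (a : Ideal R) (n : ℕ) (ha : IsRelativeCM R a (ModuleCat.of R R))
    (hn : heightWRT R a R = ((n : ℕ∞) : WithBot ℕ∞))
    (hH : gcinjDim R C ((localCohomology a n).obj (ModuleCat.of R R)) ≠ ⊤) :
    injDim R C ≠ ⊤ := by
  obtain ⟨u, hu, huniq⟩ := ha
  have hlc (i : ℕ) := (isLC_localCohomology a i (ModuleCat.of R R)).subsingleton_iff
  have hv (i : ℕ) (hi : i ≠ u) : LCVanish a i R := (hlc i).1 (by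
    by_contra h0
    exact hi (huniq i (not_subsingleton_iff_nontrivial.1 h0)))
  obtain ⟨rfl, ha⟩ := lcDegree_eq_height hCM a u n
    (fun h0 => not_subsingleton_iff_nontrivial.2 hu ((hlc u).2 h0)) hv hn
  obtain ⟨d, I, A, hd, hA, ⟨e⟩, hAm⟩ := exists_isReduction hCM hC
  have hud : u ≤ d := by
    rw [heightWRT_self] at hn
    have := hn.ge.trans (iInf₂_le (IsLocalRing.closedPoint R) (IsLocalRing.le_maximalIdeal ha))
    have := WithBot.coe_le_coe.1 this
    change (u : ℕ∞) ≤ (IsLocalRing.maximalIdeal R).height at this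
    rw [hd] at this
    exact_mod_cast this
  have hAa : IsPowTorsion a A := by
    obtain ⟨s, hs⟩ := hAm
    exact ⟨s, fun r hr => hs r (Ideal.pow_right_mono (IsLocalRing.le_maximalIdeal ha) s hr)⟩
  have hext (i : ℕ) := IsLC.ext_equiv hAa u R hv (isLC_localCohomology a u (ModuleCat.of R R)) i
  obtain ⟨g, hg⟩ := (coresDim_ne_top_iff _ _).1 hH
  obtain ⟨K, L, f, p, hs, hK, -, hL⟩ := exists_approximation hC g d hg
  have hKv (i : ℕ) := hA.ext_van_of_hasProperRes d hK i (by lia)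
  obtain ⟨e₁⟩ := hext (d - u)
  obtain ⟨e₂⟩ := hA.ext_self
  rw [Nat.sub_add_cancel hud] at e₁
  obtain ⟨g', L', F, hL', hF, hLv⟩ := hA.exists_hom_surjective (d - u) g hL
    ((e₁.trans e₂).toLinearMap.comp (ExtMod.post A p (d - u)))
    ((e₁.trans e₂).surjective.comp
      (surjective_of_exact (ExtMod.exact_post_δ A hs (d - u)) (hKv _))) fun i hi => by
      obtain ⟨e₃⟩ := hext i
      have := hA.ext_van R (i + u) (by lia)
      obtain ⟨i, rfl⟩ := Nat.exists_eq_succ_of_ne_zero (Nat.ne_zero_of_lt hi)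
      exact ExtMod.van_post₂ A hs (hKv i) e₃.toEquiv.subsingleton
  obtain ⟨S, hS⟩ := exists_section_of_cyclic e L' F hF
  have := hC.1
  refine injDim_ne_top_of_ext_van C (d + g' + 1) (hA.ext_residue_van_of_tensor _ fun i hi => ?_)
  refine ExtMod.van_retract (f := S.lTensor C) (g := F.lTensor C) ?_ _
    ((hA.ext_van_of_hasCoresDimLE hC g' hL' hLv).2 i (by lia))
  rw [← LinearMap.lTensor_comp, hS, LinearMap.lTensor_id]

end Backward

end

noncomputable section
open CategoryTheory TensorProduct

/-- Over a Cohen-Macaulay local ring with a dualizing module,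
a semidualizing module `C` is dualizing iff `G_C-id_R H_a^n(R)` is finite for some ideal
`a` with respect to which `R` is relative Cohen-Macaulay with `ht_R(a) = n`. -/
theorem stmt_8 (R : Type u) [CommRing R] [IsNoetherianRing R] [IsLocalRing R]
    (hCM : IsCohenMacaulayLocalRing R)
    (hdual : ∃ D : ModuleCat.{u} R, IsDualizing R D)
    (C : ModuleCat.{u} R) (hC : IsSemidualizing R C) :
    IsDualizing R C ↔
      ∃ (a : Ideal R) (n : ℕ), IsRelativeCM R a (ModuleCat.of R R) ∧
        heightWRT R a R = ((n : ℕ∞) : WithBot ℕ∞) ∧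
        gcinjDim R C ((localCohomology a n).obj (ModuleCat.of R R)) ≠ ⊤ := by
  constructor
  · exact fun h => ⟨⊥, 0, isRelativeCM_bot, heightWRT_bot, gcinjDim_localCohomology_bot_ne_top h⟩
  · rintro ⟨a, n, ha, hn, hH⟩
    exact ⟨hC, injDim_ne_top_of_gcinjDim_ne_top hCM hC a n ha hn hH⟩

end
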